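/- arXiv:1011.2032 — 2 statements merged into one kernel-verified Lean document; each statement's English description precedes it below -/
import Mathlib

section
/- Suppose $f,g\ge0$ satisfy $\|g\|_{L^{p_0,\infty}(w)}\le\varphi(\|w\|_{A_\infty})\|f\|_{L^{p_0}(w)}$ for every $w\in A_\infty$, with $\varphi$ locally bounded and $1\le p_0<\infty$. Then for every $0\le\alpha\le p_0$, every $0<\mu<1$, every $r>0$, and every positive locally integrable $u$, there is a constant $C$ such that for all $y>0$: $u(\{g>y\}) \le C\Big( u(\{M_r f>y\}) + y^{-(p_0-\alpha)}\int_{\mathbb{R}^n} f^{p_0-\alpha}\, M_\mu(u\,\chi_{\{g>y\}})\,dx\Big)$. -/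
open MeasureTheory ENNReal Set

noncomputable section

/-- An axis-parallel cube in `ℝⁿ`. -/
def IsCube {n : ℕ} (Q : Set (Fin n → ℝ)) : Prop :=
  ∃ (a : Fin n → ℝ) (r : ℝ), 0 < r ∧ Q = Set.Icc a (fun i => a i + r)

/-- Average of `w` over a set `Q` (w.r.t. Lebesgue measure). -/
def cubeAvg {n : ℕ} (w : (Fin n → ℝ) → ℝ≥0∞) (Q : Set (Fin n → ℝ)) : ℝ≥0∞ :=
  (∫⁻ x in Q, w x) / volume Q

/-- Hardy–Littlewood maximal operator (over cubes containing the point). -/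
def maxOp {n : ℕ} (f : (Fin n → ℝ) → ℝ≥0∞) (x : Fin n → ℝ) : ℝ≥0∞ :=
  ⨆ (Q : Set (Fin n → ℝ)) (_ : IsCube Q) (_ : x ∈ Q), cubeAvg f Q

/-- `M_μ f = (M(f^{1/μ}))^μ`. -/
def maxOpP {n : ℕ} (μ : ℝ) (f : (Fin n → ℝ) → ℝ≥0∞) (x : Fin n → ℝ) : ℝ≥0∞ :=
  (maxOp (fun y => f y ^ (1 / μ)) x) ^ μ

/-- Muckenhoupt `A_p` constant; for `p = 1` the least `C` with `Mw ≤ C w` a.e. -/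
def apConst {n : ℕ} (p : ℝ) (w : (Fin n → ℝ) → ℝ≥0∞) : ℝ≥0∞ :=
  if p = 1 then
    sInf {C : ℝ≥0∞ | ∀ᵐ x ∂(volume : Measure (Fin n → ℝ)), maxOp w x ≤ C * w x}
  else
    ⨆ (Q : Set (Fin n → ℝ)) (_ : IsCube Q),
      cubeAvg w Q * (cubeAvg (fun x => w x ^ (-1 / (p - 1))) Q) ^ (p - 1)

/-- `A_∞` "constant": infimum of the `A_p` constants over `p > 1`. -/
def ainfConst {n : ℕ} (w : (Fin n → ℝ) → ℝ≥0∞) : ℝ≥0∞ :=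
  ⨅ (p : ℝ) (_ : 1 < p), apConst p w

/-- `u(E) = ∫_E u`. -/
def wMeas {n : ℕ} (w : (Fin n → ℝ) → ℝ≥0∞) (E : Set (Fin n → ℝ)) : ℝ≥0∞ :=
  ∫⁻ x in E, w x

/-- `‖g‖_{L^{p,∞}(w)} = sup_y y · w({g>y})^{1/p}`. -/
def wkNorm {n : ℕ} (p : ℝ) (w g : (Fin n → ℝ) → ℝ≥0∞) : ℝ≥0∞ :=
  ⨆ y : ℝ≥0∞, y * (wMeas w {x | y < g x}) ^ (1 / p)

/-- `‖f‖_{L^p(w)}`. -/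
def stNorm {n : ℕ} (p : ℝ) (w f : (Fin n → ℝ) → ℝ≥0∞) : ℝ≥0∞ :=
  (∫⁻ x, f x ^ p * w x) ^ (1 / p)

/-- A locally bounded function `φ : [0,∞] → [0,∞]`. -/
def LocBdd (φ : ℝ≥0∞ → ℝ≥0∞) : Prop :=
  ∀ M : ℝ≥0∞, M ≠ ⊤ → ∃ C : ℝ≥0∞, C ≠ ⊤ ∧ ∀ t ≤ M, φ t ≤ C

/-- A (a.e.) positive, locally integrable weight. -/
def PosLocInt {n : ℕ} (u : (Fin n → ℝ) → ℝ≥0∞) : Prop :=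
  Measurable u ∧ (∀ᵐ x ∂(volume : Measure (Fin n → ℝ)), 0 < u x) ∧
    ∀ Q : Set (Fin n → ℝ), IsCube Q → (∫⁻ x in Q, u x) < ⊤

end

noncomputable section

open Metric in
lemma isCube_iff {n : ℕ} (Q : Set (Fin n → ℝ)) :
    IsCube Q ↔ ∃ (c : Fin n → ℝ) (ρ : ℝ), 0 < ρ ∧ Q = closedBall c ρ := by
  constructor
  · rintro ⟨a, r, hr, rfl⟩
    refine ⟨fun i => a i + r / 2, r / 2, by positivity, ?_⟩
    rw [closedBall_pi _ (by positivity), ← Set.pi_univ_Icc]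
    congr 1; ext i : 1
    rw [Real.closedBall_eq_Icc]
    congr 1 <;> ring
  · rintro ⟨c, ρ, hρ, rfl⟩
    refine ⟨fun i => c i - ρ, 2 * ρ, by positivity, ?_⟩
    rw [closedBall_pi _ hρ.le, ← Set.pi_univ_Icc]
    congr 1; ext i : 1
    rw [Real.closedBall_eq_Icc]
    congr 1; ring

open Metric in
lemma vol_pos {n : ℕ} (c : Fin n → ℝ) {ρ : ℝ} (hρ : 0 < ρ) : volume (closedBall c ρ) ≠ 0 :=
  (measure_closedBall_pos _ _ hρ).ne'

open Metric in
lemma vol_top {n : ℕ} (c : Fin n → ℝ) (ρ : ℝ) : volume (closedBall c ρ) ≠ ⊤ :=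
  measure_closedBall_lt_top.ne

open Metric in
lemma vol_mul {n : ℕ} (c c' : Fin n → ℝ) {ρ : ℝ} (hρ : 0 < ρ) (k : ℕ) :
    volume (closedBall c (k * ρ)) = (k : ℝ≥0∞) ^ n * volume (closedBall c' ρ) := by
  rw [Real.volume_pi_closedBall _ (by positivity), Real.volume_pi_closedBall _ hρ.le,
    ← ENNReal.ofReal_natCast, ← ENNReal.ofReal_pow (by positivity),
    ← ENNReal.ofReal_mul (by positivity), Fintype.card_fin]
  congr 1
  rw [← mul_pow]; congr 1; ring

open Metric in
lemma le_maxOp {n : ℕ} (F : (Fin n → ℝ) → ℝ≥0∞) {c x : Fin n → ℝ} {ρ : ℝ} (hρ : 0 < ρ)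
    (hx : x ∈ closedBall c ρ) :
    ∫⁻ z in closedBall c ρ, F z ≤ maxOp F x * volume (closedBall c ρ) := by
  rw [← ENNReal.div_le_iff (vol_pos c hρ) (vol_top c ρ)]
  unfold maxOp
  exact le_iSup_of_le (closedBall c ρ) (le_iSup_of_le ((isCube_iff _).2 ⟨c, ρ, hρ, rfl⟩)
    (le_iSup_of_le hx le_rfl))

open Metric in
lemma lt_maxOp {n : ℕ} {F : (Fin n → ℝ) → ℝ≥0∞} {x : Fin n → ℝ} {l : ℝ≥0∞} (h : l < maxOp F x) :
    ∃ (c : Fin n → ℝ) (ρ : ℝ), 0 < ρ ∧ x ∈ closedBall c ρ ∧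
      l * volume (closedBall c ρ) < ∫⁻ z in closedBall c ρ, F z := by
  unfold maxOp at h
  simp only [lt_iSup_iff] at h
  obtain ⟨Q, hQ, hx, h⟩ := h
  obtain ⟨c, ρ, hρ, rfl⟩ := (isCube_iff _).1 hQ
  refine ⟨c, ρ, hρ, hx, ?_⟩
  unfold cubeAvg at h
  rwa [ENNReal.lt_div_iff_mul_lt (Or.inl (vol_pos c hρ)) (Or.inl (vol_top c ρ))] at h

open Metric Filter Topology in
lemma measurable_maxOp {n : ℕ} (F : (Fin n → ℝ) → ℝ≥0∞) : Measurable (maxOp F) := by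
  apply measurable_of_Ioi
  intro l
  apply IsOpen.measurableSet
  rw [isOpen_iff_mem_nhds]
  intro x hx
  simp only [mem_preimage, mem_Ioi] at hx
  obtain ⟨c, ρ, hρ, hxc, h⟩ := lt_maxOp hx
  have hl : l ≠ ⊤ := hx.ne_top
  have hcont : Tendsto (fun s : ℝ => l * ENNReal.ofReal ((2 * s) ^ n)) (𝓝[>] ρ)
      (𝓝 (l * ENNReal.ofReal ((2 * ρ) ^ n))) := by
    apply ENNReal.Tendsto.const_mul _ (Or.inr hl)
    apply ENNReal.tendsto_ofReal
    exact ((by fun_prop : Continuous fun s : ℝ => (2 * s) ^ n).tendsto ρ).mono_left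
      nhdsWithin_le_nhds
  rw [Real.volume_pi_closedBall _ hρ.le, Fintype.card_fin] at h
  obtain ⟨s, hs, hs'⟩ := ((hcont.eventually_lt_const h).and self_mem_nhdsWithin).exists
  have hs' : ρ < s := hs'
  have hs0 : 0 < s := hρ.trans hs'
  have : closedBall c s ∈ 𝓝 x := by
    apply closedBall_mem_nhds_of_mem
    exact mem_ball.2 (lt_of_le_of_lt (mem_closedBall.1 hxc) hs')
  filter_upwards [this] with z hz
  simp only [mem_preimage, mem_Ioi]
  by_contra hcon
  have h1 := le_maxOp F hs0 hz
  have h2 : ∫⁻ z in closedBall c ρ, F z ≤ ∫⁻ z in closedBall c s, F z :=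
    lintegral_mono_set (closedBall_subset_closedBall hs'.le)
  have h3 : maxOp F z * volume (closedBall c s) ≤ l * volume (closedBall c s) :=
    mul_le_mul_left (not_lt.1 hcon) _
  rw [Real.volume_pi_closedBall _ hs0.le, Fintype.card_fin] at h1 h3
  exact absurd (h2.trans (h1.trans h3)) (not_le.2 hs)

open Metric in
/-- zero alternative -/
lemma maxOp_eq_zero {n : ℕ} {F : (Fin n → ℝ) → ℝ≥0∞} {x : Fin n → ℝ} (h : maxOp F x = 0)
    (hF : Measurable F) : ∀ᵐ z, F z = 0 := by
  have h1 : ∀ k : ℕ, ∀ᵐ z, z ∈ closedBall x (k + 1 : ℝ) → F z = 0 := by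
    intro k
    have hk : (0 : ℝ) < k + 1 := by positivity
    have := le_maxOp F hk (mem_closedBall_self hk.le : x ∈ closedBall x _)
    rw [h, zero_mul, nonpos_iff_eq_zero, lintegral_eq_zero_iff hF] at this
    exact (ae_restrict_iff' isClosed_closedBall.measurableSet).1 this
  filter_upwards [ae_all_iff.2 h1] with z hz
  obtain ⟨k, hk⟩ := exists_nat_ge (dist z x)
  exact hz k (mem_closedBall.2 (hk.trans (by linarith)))

open Metric in
lemma weak_type {n : ℕ} (F : (Fin n → ℝ) → ℝ≥0∞) (c : Fin n → ℝ) {ρ : ℝ} (l : ℝ≥0∞) :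
    l * volume {z | z ∈ closedBall c ρ ∧ ∃ (d : Fin n → ℝ) (s : ℝ), 0 < s ∧ s ≤ ρ ∧
      z ∈ closedBall d s ∧ l * volume (closedBall d s) ≤ ∫⁻ x in closedBall d s, F x}
      ≤ 5 ^ n * ∫⁻ x in closedBall c (3 * ρ), F x := by
  set E := {z | z ∈ closedBall c ρ ∧ ∃ (d : Fin n → ℝ) (s : ℝ), 0 < s ∧ s ≤ ρ ∧
      z ∈ closedBall d s ∧ l * volume (closedBall d s) ≤ ∫⁻ x in closedBall d s, F x} with hE
  let t : Set ((Fin n → ℝ) × ℝ) := {p | 0 < p.2 ∧ p.2 ≤ ρ ∧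
    l * volume (closedBall p.1 p.2) ≤ ∫⁻ x in closedBall p.1 p.2, F x ∧
    closedBall p.1 p.2 ⊆ closedBall c (3 * ρ)}
  obtain ⟨v, hvt, hdisj, hcov⟩ := Vitali.exists_disjoint_subfamily_covering_enlargement_closedBall
    t (fun p => p.1) (fun p => p.2) ρ (fun p hp => hp.2.1) 5 (by norm_num)
  have hcount : v.Countable := hdisj.countable_of_nonempty_interior fun p hp =>
    (nonempty_ball.2 (hvt hp).1).mono ball_subset_interior_closedBall
  have hEsub : E ⊆ ⋃ p ∈ v, closedBall p.1 (5 * p.2) := by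
    rintro z ⟨hz, d, s, hs, hsρ, hzd, hl⟩
    have hmem : (d, s) ∈ t := by
      refine ⟨hs, hsρ, hl, ?_⟩
      intro w hw
      have h1 := mem_closedBall.1 hw
      have h2 := mem_closedBall'.1 hzd
      have h3 := mem_closedBall.1 hz
      rw [mem_closedBall]
      have := dist_triangle4 w d z c
      simp only at h1
      linarith
    obtain ⟨b, hb, hsub⟩ := hcov _ hmem
    exact mem_biUnion hb (hsub hzd)
  calc l * volume E ≤ l * ∑' p : v, volume (closedBall p.1.1 (5 * p.1.2)) := by
        gcongr
        exact (measure_mono hEsub).trans (measure_biUnion_le _ hcount _)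
    _ = ∑' p : v, 5 ^ n * (l * volume (closedBall p.1.1 p.1.2)) := by
        rw [← ENNReal.tsum_mul_left]
        congr 1; ext p
        have := vol_mul p.1.1 p.1.1 (hvt p.2).1 5
        push_cast at this
        rw [this]; ring
    _ ≤ ∑' p : v, 5 ^ n * ∫⁻ x in closedBall p.1.1 p.1.2, F x := by
        gcongr with p
        exact (hvt p.2).2.2.1
    _ = 5 ^ n * ∫⁻ x in ⋃ p ∈ v, closedBall p.1 p.2, F x := by
        rw [ENNReal.tsum_mul_left, lintegral_biUnion hcount
          (fun _ _ => isClosed_closedBall.measurableSet) hdisj]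
    _ ≤ _ := by
        gcongr
        exact iUnion₂_subset fun p hp => (hvt hp).2.2.2

lemma one_le_rpow_aux {x : ℝ≥0∞} {δ : ℝ} (hδ : 0 ≤ δ) (hx : 1 ≤ x) : 1 ≤ x ^ δ := by
  simpa using ENNReal.rpow_le_rpow hx hδ

lemma dyadic_bound {A M : ℝ≥0∞} (hA0 : A ≠ 0) (hAt : A ≠ ⊤) {δ : ℝ} (hδ : 0 ≤ δ)
    (P : ℕ → Prop) [DecidablePred P] (hP : ∀ k : ℕ, 2 ^ k * A < M → P k) :
    M ^ δ ≤ A ^ δ * (1 + ∑' k : ℕ, (2 ^ (k + 1) : ℝ≥0∞) ^ δ * (if P k then 1 else 0)) := by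
  by_cases hMA : M ≤ A
  · calc M ^ δ ≤ A ^ δ := ENNReal.rpow_le_rpow hMA hδ
      _ = A ^ δ * 1 := (mul_one _).symm
      _ ≤ _ := by gcongr; exact le_self_add
  rw [not_le] at hMA
  by_cases hM : M = ⊤
  · have hall : ∀ k, P k := fun k => hP k (by
      rw [hM]; exact ENNReal.mul_lt_top (by simp) hAt.lt_top)
    have : ∑' k : ℕ, (2 ^ (k + 1) : ℝ≥0∞) ^ δ * (if P k then 1 else 0) = ⊤ := by
      rw [eq_top_iff, ← ENNReal.tsum_const_eq_top_of_ne_zero (α := ℕ) (c := 1) one_ne_zero]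
      refine ENNReal.tsum_le_tsum fun k => ?_
      simp only [hall k, if_true, mul_one]
      exact one_le_rpow_aux hδ (one_le_pow₀ (by norm_num))
    rw [this, add_top, ENNReal.mul_top]
    · exact le_top
    · simp [ENNReal.rpow_eq_zero_iff, hA0, hAt]
  have hex : ∃ k : ℕ, M ≤ 2 ^ (k + 1) * A := by
    obtain ⟨k, hk⟩ := ENNReal.exists_nat_mul_gt hA0 hM
    refine ⟨k, hk.le.trans ?_⟩
    gcongr
    have : (k : ℝ≥0∞) ≤ ((2 ^ (k + 1) : ℕ) : ℝ≥0∞) := by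
      exact_mod_cast (Nat.lt_two_pow_self.le.trans (Nat.pow_le_pow_right (by norm_num) (by omega)))
    simpa using this
  classical
  have hk1 := Nat.find_spec hex
  have hk2 : 2 ^ (Nat.find hex) * A < M := by
    rcases hj : Nat.find hex with _ | j
    · simpa using hMA
    · exact not_le.1 (Nat.find_min hex (m := j) (by omega))
  calc M ^ δ ≤ (2 ^ (Nat.find hex + 1) * A) ^ δ := ENNReal.rpow_le_rpow hk1 hδ
    _ = A ^ δ * ((2 ^ (Nat.find hex + 1) : ℝ≥0∞) ^ δ * (if P (Nat.find hex) then 1 else 0)) := by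
        rw [ENNReal.mul_rpow_of_nonneg _ _ hδ, if_pos (hP _ hk2), mul_one, mul_comm]
    _ ≤ _ := by
        gcongr
        refine le_trans ?_ le_add_self
        exact ENNReal.le_tsum (f := fun k : ℕ => (2 ^ (k + 1) : ℝ≥0∞) ^ δ * (if P k then 1 else 0)) _

def a1C (n : ℕ) (δ : ℝ) : ℝ≥0∞ :=
  (3 ^ n : ℝ≥0∞) ^ δ * (1 + 5 ^ n * ∑' k : ℕ, (2 ^ (k + 1) : ℝ≥0∞) ^ δ * (2 ^ k)⁻¹)

lemma a1C_ne_top (n : ℕ) {δ : ℝ} (hδ : 0 ≤ δ) (hδ1 : δ < 1) : a1C n δ ≠ ⊤ := by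
  have h1 : ∀ k : ℕ, (2 ^ (k + 1) : ℝ≥0∞) ^ δ * (2 ^ k)⁻¹ = 2 ^ δ * (2 ^ (δ - 1)) ^ k := by
    intro k
    rw [← ENNReal.rpow_natCast, ← ENNReal.rpow_natCast, ← ENNReal.rpow_natCast, ← ENNReal.rpow_mul,
      ← ENNReal.rpow_neg, ← ENNReal.rpow_mul, ← ENNReal.rpow_add _ _ (by norm_num) (by norm_num),
      ← ENNReal.rpow_add _ _ (by norm_num) (by norm_num)]
    congr 1; push_cast; ring
  unfold a1C
  simp_rw [h1]
  rw [ENNReal.tsum_mul_left, ENNReal.tsum_geometric]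
  have h2 : (2 : ℝ≥0∞) ^ (δ - 1) < 1 := ENNReal.rpow_lt_one_of_one_lt_of_neg (by norm_num) (by linarith)
  have h3 : (1 - (2 : ℝ≥0∞) ^ (δ - 1))⁻¹ ≠ ⊤ := by
    simp only [ne_eq, ENNReal.inv_eq_top]
    exact (tsub_pos_of_lt h2).ne'
  have h4 : (2 : ℝ≥0∞) ^ δ ≠ ⊤ := ENNReal.rpow_ne_top_of_nonneg hδ (by norm_num)
  have h5 : (3 ^ n : ℝ≥0∞) ^ δ ≠ ⊤ := ENNReal.rpow_ne_top_of_nonneg hδ (by simp)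
  have h6 : (5 ^ n : ℝ≥0∞) ≠ ⊤ := by simp
  finiteness

lemma a1C_ge (n : ℕ) {δ : ℝ} (hδ : 0 ≤ δ) : 1 ≤ a1C n δ := by
  unfold a1C
  exact one_le_mul (one_le_rpow_aux hδ (one_le_pow₀ (by norm_num))) le_self_add

open Metric in
lemma a1_bound {n : ℕ} {δ : ℝ} (hδ : 0 ≤ δ) {F : (Fin n → ℝ) → ℝ≥0∞} (hF : Measurable F)
    {c x : Fin n → ℝ} {ρ : ℝ} (hρ : 0 < ρ) (hx : x ∈ closedBall c ρ) :
    ∫⁻ z in closedBall c ρ, maxOp F z ^ δ ≤ a1C n δ * maxOp F x ^ δ * volume (closedBall c ρ) := by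
  classical
  by_cases h0 : maxOp F x = 0
  · have hae := maxOp_eq_zero h0 hF
    have : ∀ z, maxOp F z = 0 := by
      intro z
      by_contra hz
      obtain ⟨d, s, hs, -, h⟩ := lt_maxOp (pos_iff_ne_zero.2 hz)
      rw [lintegral_congr_ae (ae_restrict_of_ae hae)] at h
      simp at h
    simp only [this, lintegral_const, Measure.restrict_apply_univ]
    gcongr
    exact le_mul_of_one_le_left (by positivity) (a1C_ge n hδ)
  by_cases ht : maxOp F x = ⊤
  · rcases hδ.eq_or_lt with rfl | hδ'
    · simp only [ENNReal.rpow_zero, lintegral_const, Measure.restrict_apply_univ, mul_one]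
      gcongr
      exact a1C_ge n le_rfl
    · rw [ht, ENNReal.top_rpow_of_pos hδ', ENNReal.mul_top, ENNReal.top_mul (vol_pos c hρ)]
      · exact le_top
      · exact (lt_of_lt_of_le one_pos (a1C_ge n hδ)).ne'
  set m := maxOp F x with hm
  set A : ℝ≥0∞ := 3 ^ n * m with hA
  have hA0 : A ≠ 0 := mul_ne_zero (by simp) h0
  have hAt : A ≠ ⊤ := ENNReal.mul_ne_top (by simp) ht
  set E : ℕ → Set (Fin n → ℝ) := fun k => toMeasurable volume
    {z | z ∈ closedBall c ρ ∧ ∃ (d : Fin n → ℝ) (s : ℝ), 0 < s ∧ s ≤ ρ ∧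
      z ∈ closedBall d s ∧ 2 ^ k * A * volume (closedBall d s) ≤ ∫⁻ x in closedBall d s, F x} with hE
  have hEm : ∀ k, MeasurableSet (E k) := fun k => measurableSet_toMeasurable _ _
  have hEvol : ∀ k, volume (E k) ≤ 5 ^ n * ((2 ^ k)⁻¹ * volume (closedBall c ρ)) := by
    intro k
    have h1 := weak_type F c (ρ := ρ) (2 ^ k * A)
    rw [← measure_toMeasurable] at h1
    have h2 : ∫⁻ x in closedBall c (3 * ρ), F x ≤ A * volume (closedBall c ρ) := by
      have h3 : x ∈ closedBall c (3 * ρ) := closedBall_subset_closedBall (by linarith) hx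
      refine (le_maxOp F (by positivity) h3).trans ?_
      have := vol_mul c c hρ 3
      push_cast at this
      rw [this, hA, ← hm]
      apply le_of_eq; ring
    have h4 := h1.trans (mul_le_mul_right h2 _)
    have h5 : A * (2 ^ k * volume (E k)) ≤ A * (5 ^ n * volume (closedBall c ρ)) := by
      calc _ = 2 ^ k * A * volume (E k) := by ring
        _ ≤ _ := h4
        _ = _ := by ring
    rw [ENNReal.mul_le_mul_iff_right hA0 hAt] at h5
    have h6 := mul_le_mul_right h5 ((2 ^ k : ℝ≥0∞)⁻¹)
    rw [← mul_assoc, ENNReal.inv_mul_cancel (by simp) (by simp), one_mul] at h6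
    refine h6.trans (le_of_eq ?_)
    ring
  have hpt : ∀ z ∈ closedBall c ρ, maxOp F z ^ δ ≤
      A ^ δ * (1 + ∑' k : ℕ, (2 ^ (k + 1) : ℝ≥0∞) ^ δ * (E k).indicator 1 z) := by
    intro z hz
    have := dyadic_bound (M := maxOp F z) hA0 hAt hδ (fun k => z ∈ E k) ?_
    · simpa only [Set.indicator_apply, Pi.one_apply] using this
    intro k hk
    obtain ⟨d, s, hs, hzd, h⟩ := lt_maxOp hk
    apply subset_toMeasurable
    refine ⟨hz, d, s, hs, ?_, hzd, h.le⟩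
    by_contra hsρ
    rw [not_le] at hsρ
    have hxd : x ∈ closedBall d (3 * s) := by
      have h1 := mem_closedBall.1 hx
      have h2 := mem_closedBall'.1 hz
      have h3 := mem_closedBall.1 hzd
      rw [mem_closedBall]
      have := dist_triangle4 x c z d
      linarith
    have h1 := le_maxOp F (by positivity) hxd
    have h2 : ∫⁻ x in closedBall d s, F x ≤ ∫⁻ x in closedBall d (3 * s), F x :=
      lintegral_mono_set (closedBall_subset_closedBall (by linarith))
    have h3 := vol_mul d d hs 3
    push_cast at h3
    rw [h3, ← hm] at h1
    have h4 : A * volume (closedBall d s) ≤ 2 ^ k * A * volume (closedBall d s) := by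
      gcongr
      exact le_mul_of_one_le_left (by positivity) (one_le_pow₀ (by norm_num))
    refine absurd (lt_of_le_of_lt h4 (h.trans_le (h2.trans h1))) (not_lt.2 (le_of_eq ?_))
    rw [hA]; ring
  calc ∫⁻ z in closedBall c ρ, maxOp F z ^ δ
      ≤ ∫⁻ z in closedBall c ρ,
        A ^ δ * (1 + ∑' k : ℕ, (2 ^ (k + 1) : ℝ≥0∞) ^ δ * (E k).indicator 1 z) :=
        setLIntegral_mono' isClosed_closedBall.measurableSet hpt
    _ = A ^ δ * (volume (closedBall c ρ) + ∑' k : ℕ, (2 ^ (k + 1) : ℝ≥0∞) ^ δ *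
          (volume.restrict (closedBall c ρ)) (E k)) := by
        have hmeas : ∀ k, Measurable fun z => (2 ^ (k + 1) : ℝ≥0∞) ^ δ * (E k).indicator 1 z :=
          fun k => (measurable_one.indicator (hEm k)).const_mul _
        rw [lintegral_const_mul' _ _ (ENNReal.rpow_ne_top_of_nonneg hδ hAt),
          lintegral_add_left measurable_const, lintegral_tsum (fun k => (hmeas k).aemeasurable)]
        congr 2
        · simp
        · congr 1; ext k
          rw [lintegral_const_mul _ (measurable_one.indicator (hEm k)),
            lintegral_indicator_one (hEm k)]
    _ ≤ A ^ δ * (volume (closedBall c ρ) + ∑' k : ℕ, (2 ^ (k + 1) : ℝ≥0∞) ^ δ *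
          (5 ^ n * ((2 ^ k)⁻¹ * volume (closedBall c ρ)))) := by
        gcongr with k
        exact (Measure.restrict_apply_le _ _).trans (hEvol k)
    _ = _ := by
        have : ∀ k : ℕ, (2 ^ (k + 1) : ℝ≥0∞) ^ δ * (5 ^ n * ((2 ^ k)⁻¹ * volume (closedBall c ρ)))
          = 5 ^ n * volume (closedBall c ρ) * ((2 ^ (k + 1) : ℝ≥0∞) ^ δ * (2 ^ k)⁻¹) := by
          intro k; ring
        simp_rw [this]
        rw [ENNReal.tsum_mul_left, hA, ENNReal.mul_rpow_of_nonneg _ _ hδ, a1C]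
        ring

open Metric in
lemma maxOp_ae_lt_top {n : ℕ} {F : (Fin n → ℝ) → ℝ≥0∞} (hF : Measurable F) {x : Fin n → ℝ}
    (hx : maxOp F x ≠ ⊤) : ∀ᵐ z, maxOp F z ≠ ⊤ := by
  have h1 : ∀ k : ℕ, ∀ᵐ z, z ∈ closedBall x (k + 1 : ℝ) → maxOp F z ≠ ⊤ := by
    intro k
    have hk : (0 : ℝ) < k + 1 := by positivity
    have h := a1_bound (δ := 1 / 2) (by norm_num) hF hk (mem_closedBall_self hk.le : x ∈ closedBall x _)
    have h2 : ∫⁻ z in closedBall x (k + 1 : ℝ), maxOp F z ^ (1 / 2 : ℝ) ≠ ⊤ := by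
      refine ne_top_of_le_ne_top ?_ h
      have := a1C_ne_top n (δ := 1 / 2) (by norm_num) (by norm_num)
      have h3 := vol_top x (k + 1 : ℝ)
      have h4 : maxOp F x ^ (1 / 2 : ℝ) ≠ ⊤ := ENNReal.rpow_ne_top_of_nonneg (by norm_num) hx
      finiteness
    have h3 := ae_lt_top ((measurable_maxOp F).pow_const _) h2
    rw [ae_restrict_iff' isClosed_closedBall.measurableSet] at h3
    filter_upwards [h3] with z hz hzm hzt
    have := hz hzm
    rw [hzt, ENNReal.top_rpow_of_pos (by norm_num)] at this
    exact absurd this (lt_irrefl _)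
  filter_upwards [ae_all_iff.2 h1] with z hz
  obtain ⟨k, hk⟩ := exists_nat_ge (dist z x)
  exact hz k (mem_closedBall.2 (hk.trans (by linarith)))

open Metric Filter Topology in
lemma ae_le_maxOp {n : ℕ} {F : (Fin n → ℝ) → ℝ≥0∞} (hF : Measurable F) :
    ∀ᵐ z, F z ≤ maxOp F z := by
  by_cases hall : ∀ z, maxOp F z = ⊤
  · exact Eventually.of_forall fun z => by rw [hall z]; exact le_top
  push Not at hall
  obtain ⟨x, hx⟩ := hall
  have : IsLocallyFiniteMeasure (volume.withDensity F) := by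
    refine ⟨fun z => ⟨closedBall z (dist x z + 1), closedBall_mem_nhds _ (by positivity), ?_⟩⟩
    rw [withDensity_apply _ isClosed_closedBall.measurableSet]
    refine (le_maxOp F (x := x) (by positivity) (mem_closedBall.2 (by linarith))).trans_lt ?_
    exact ENNReal.mul_lt_top hx.lt_top (vol_top _ _).lt_top
  filter_upwards [Besicovitch.ae_tendsto_rnDeriv (volume.withDensity F) volume,
    Measure.rnDeriv_withDensity volume hF] with z hz hz'
  rw [hz'] at hz
  refine le_of_tendsto hz ?_
  filter_upwards [self_mem_nhdsWithin] with s hs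
  have hs : 0 < s := hs
  rw [withDensity_apply _ isClosed_closedBall.measurableSet,
    ENNReal.div_le_iff (vol_pos _ hs) (vol_top _ _)]
  exact le_maxOp F hs (mem_closedBall_self hs.le)

open Metric in
lemma ap_bound {n : ℕ} {F G : (Fin n → ℝ) → ℝ≥0∞} (hF : Measurable F) (hG : Measurable G)
    {δ μ s : ℝ} (hδ : 0 ≤ δ) (hδ1 : δ < 1) (hμ : 0 < μ) (hμ1 : μ < 1) (hs : 0 < s)
    (hG0 : ∀ z, maxOp G z ≠ 0) (hFt : ∀ᵐ z, maxOp F z ≠ ⊤) :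
    apConst (s + 1) (fun z => maxOp G z ^ μ * (maxOp F z ^ δ) ^ (-s)) ≤ a1C n μ * a1C n δ ^ s := by
  unfold apConst
  rw [if_neg (by linarith)]
  refine iSup₂_le fun Q hQ => ?_
  obtain ⟨c, ρ, hρ, rfl⟩ := (isCube_iff _).1 hQ
  have hs1 : s + 1 - 1 = s := by ring
  simp only [hs1]
  set W1 := fun z => maxOp G z ^ μ with hW1
  set W2 := fun z => maxOp F z ^ δ with hW2
  have hm1 : Measurable W1 := (measurable_maxOp G).pow_const _
  have hm2 : Measurable W2 := (measurable_maxOp F).pow_const _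
  set B := closedBall c ρ with hB
  have hBm : MeasurableSet B := isClosed_closedBall.measurableSet
  set a1 := cubeAvg W1 B with ha1
  set a2 := cubeAvg W2 B with ha2
  have key : ∀ z ∈ B, a1 ≤ a1C n μ * W1 z := fun z hz => by
    rw [ha1, cubeAvg, ENNReal.div_le_iff (vol_pos c hρ) (vol_top c ρ)]
    exact a1_bound hμ.le hG hρ hz
  have key2 : ∀ z ∈ B, a2 ≤ a1C n δ * W2 z := fun z hz => by
    rw [ha2, cubeAvg, ENNReal.div_le_iff (vol_pos c hρ) (vol_top c ρ)]
    exact a1_bound hδ hF hρ hz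
  have c1 : a1C n μ ≠ 0 := (lt_of_lt_of_le one_pos (a1C_ge n hμ.le)).ne'
  have c2 : a1C n δ ≠ 0 := (lt_of_lt_of_le one_pos (a1C_ge n hδ)).ne'
  have t1 : a1C n μ ≠ ⊤ := a1C_ne_top n hμ.le hμ1
  have t2 : a1C n δ ≠ ⊤ := a1C_ne_top n hδ hδ1
  have inv : ∀ {a C w : ℝ≥0∞}, C ≠ 0 → C ≠ ⊤ → a ≤ C * w → w⁻¹ ≤ C / a := by
    intro a C w hC hCt h
    have h1 : (a / C)⁻¹ = C / a := ENNReal.inv_div (Or.inl hCt) (Or.inl hC)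
    rw [← h1, ENNReal.inv_le_inv]
    exact ENNReal.div_le_of_le_mul' h
  have e1 : cubeAvg (fun z => W1 z * W2 z ^ (-s)) B ≤ a1 * (a1C n δ / a2) ^ s := by
    unfold cubeAvg
    have : ∫⁻ z in B, W1 z * W2 z ^ (-s) ≤ ∫⁻ z in B, W1 z * (a1C n δ / a2) ^ s := by
      refine setLIntegral_mono' hBm fun z hz => ?_
      gcongr
      rw [ENNReal.rpow_neg, ← ENNReal.inv_rpow]
      exact ENNReal.rpow_le_rpow (inv c2 t2 (key2 z hz)) hs.le
    rw [lintegral_mul_const _ hm1] at this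
    refine (ENNReal.div_le_div_right this _).trans (le_of_eq ?_)
    have hav : a1 = (∫⁻ z in B, W1 z) * (volume B)⁻¹ := by rw [ha1, cubeAvg, div_eq_mul_inv]
    rw [ENNReal.div_eq_inv_mul]; nth_rewrite 1 [hav]; ring
  have e2 : cubeAvg (fun z => (W1 z * W2 z ^ (-s)) ^ (-1 / s)) B
      ≤ (a1C n μ / a1) ^ (1 / s) * a2 := by
    unfold cubeAvg
    have : ∫⁻ z in B, (W1 z * W2 z ^ (-s)) ^ (-1 / s) ≤
        ∫⁻ z in B, (a1C n μ / a1) ^ (1 / s) * W2 z := by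
      refine lintegral_mono_ae ?_
      rw [ae_restrict_iff' hBm]
      filter_upwards [hFt] with z hz hzB
      have h1 : W1 z ≠ 0 := by
        simp only [hW1, ne_eq, ENNReal.rpow_eq_zero_iff, not_or, not_and]
        exact ⟨fun h => absurd h (hG0 z), fun _ => by linarith⟩
      have h2 : W2 z ≠ ⊤ := ENNReal.rpow_ne_top_of_nonneg hδ hz
      have h3 : W2 z ^ (-s) ≠ 0 := by
        simp only [ne_eq, ENNReal.rpow_eq_zero_iff, not_or, not_and]
        exact ⟨fun h => by linarith, fun h => absurd h h2⟩
      rw [neg_div, ENNReal.rpow_neg, ← ENNReal.inv_rpow, ENNReal.mul_inv (Or.inl h1) (Or.inr h3),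
        ENNReal.mul_rpow_of_nonneg _ _ (by positivity), ← ENNReal.rpow_neg (W2 z), neg_neg,
        ← ENNReal.rpow_mul, mul_one_div_cancel hs.ne', ENNReal.rpow_one]
      gcongr
      exact inv c1 t1 (key z hzB)
    rw [lintegral_const_mul _ hm2] at this
    refine (ENNReal.div_le_div_right this _).trans (le_of_eq ?_)
    have hav : a2 = (∫⁻ z in B, W2 z) * (volume B)⁻¹ := by rw [ha2, cubeAvg, div_eq_mul_inv]
    rw [ENNReal.div_eq_inv_mul]; nth_rewrite 1 [hav]; ring
  calc _ ≤ (a1 * (a1C n δ / a2) ^ s) * ((a1C n μ / a1) ^ (1 / s) * a2) ^ s := by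
        gcongr
    _ = (a1 * (a1C n μ / a1)) * (a2 * (a1C n δ / a2)) ^ s := by
        rw [ENNReal.mul_rpow_of_nonneg _ _ hs.le, ENNReal.mul_rpow_of_nonneg _ _ hs.le,
          ← ENNReal.rpow_mul, one_div_mul_cancel hs.ne', ENNReal.rpow_one]
        ring
    _ ≤ _ := by
        gcongr <;> exact ENNReal.mul_div_le

lemma ainf_one {n : ℕ} : ainfConst (fun _ : Fin n → ℝ => (1 : ℝ≥0∞)) < ⊤ := by
  refine lt_of_le_of_lt (iInf₂_le (2 : ℝ) (by norm_num)) ?_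
  unfold apConst
  rw [if_neg (by norm_num)]
  refine lt_of_le_of_lt (b := 1) (iSup₂_le fun Q hQ => ?_) (by simp)
  obtain ⟨c, ρ, hρ, rfl⟩ := (isCube_iff _).1 hQ
  simp [cubeAvg, ENNReal.div_self (vol_pos c hρ) (vol_top c ρ)]

theorem stmt3 {n : ℕ} (p₀ : ℝ) (hp₀ : 1 ≤ p₀)
    (f g : (Fin n → ℝ) → ℝ≥0∞) (hf : Measurable f) (hg : Measurable g)
    (φ : ℝ≥0∞ → ℝ≥0∞) (hφ : LocBdd φ)
    (H : ∀ w : (Fin n → ℝ) → ℝ≥0∞, Measurable w → ainfConst w < ⊤ →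
      wkNorm p₀ w g ≤ φ (ainfConst w) * stNorm p₀ w f)
    (α μ r : ℝ) (hα0 : 0 ≤ α) (hα : α ≤ p₀) (hμ0 : 0 < μ) (hμ1 : μ < 1) (hr : 0 < r)
    (u : (Fin n → ℝ) → ℝ≥0∞) (hu : PosLocInt u) :
    ∃ C : ℝ≥0∞, C < ⊤ ∧ ∀ y : ℝ≥0∞, 0 < y →
      wMeas u {x | y < g x} ≤
        C * (wMeas u {x | y < maxOpP r f x}
          + y ^ (-(p₀ - α)) *
            ∫⁻ x, f x ^ (p₀ - α) * maxOpP μ (Set.indicator {x | y < g x} u) x) := by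
  set s : ℝ := 1 + r * α with hs
  have hrα : 0 ≤ r * α := mul_nonneg hr.le hα0
  have hs0 : 0 < s := by linarith
  set δ : ℝ := r * α / s with hδd
  have hδ : 0 ≤ δ := by positivity
  have hδ1 : δ < 1 := by rw [hδd, div_lt_one hs0]; linarith
  have hδs : δ * s = r * α := div_mul_cancel₀ _ hs0.ne'
  have hp0 : 0 < p₀ := by linarith
  have hCt : a1C n μ * a1C n δ ^ s ≠ ⊤ := ENNReal.mul_ne_top (a1C_ne_top n hμ0.le hμ1)
    (ENNReal.rpow_ne_top_of_nonneg hs0.le (a1C_ne_top n hδ hδ1))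
  obtain ⟨K, hKt, hK⟩ := hφ _ hCt
  refine ⟨1 + K ^ p₀, ?_, ?_⟩
  · have := ENNReal.rpow_ne_top_of_nonneg hp0.le hKt
    finiteness
  intro y hy
  by_cases hyt : y = ⊤
  · simp [hyt, wMeas]
  set F : (Fin n → ℝ) → ℝ≥0∞ := fun z => f z ^ (1 / r) with hFd
  have hF : Measurable F := hf.pow_const _
  have hMf : ∀ z, maxOpP r f z = maxOp F z ^ r := fun z => rfl
  have hSm : MeasurableSet {x | y < g x} := measurableSet_lt measurable_const hg
  -- case of an identically infinite maximal function
  by_cases hall : ∀ z, maxOp F z = ⊤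
  · have h1 : {x | y < maxOpP r f x} = Set.univ := by
      ext z
      simp [hMf, hall z, ENNReal.top_rpow_of_pos hr, lt_top_iff_ne_top, hyt]
    rw [h1]
    calc wMeas u {x | y < g x} ≤ wMeas u Set.univ := lintegral_mono_set (Set.subset_univ _)
      _ ≤ _ := le_self_add
      _ ≤ _ := le_mul_of_one_le_left (by positivity) le_self_add
  push Not at hall
  obtain ⟨x₀, hx₀⟩ := hall
  have hFt := maxOp_ae_lt_top hF hx₀
  -- case `f = 0`
  by_cases hf0 : ∀ᵐ z, f z = 0
  · have h1 := H (fun _ => 1) measurable_const ainf_one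
    have h2 : stNorm p₀ (fun _ => 1) f = 0 := by
      unfold stNorm
      have : ∫⁻ x, f x ^ p₀ * 1 = ∫⁻ x : Fin n → ℝ, 0 := by
        apply lintegral_congr_ae
        filter_upwards [hf0] with z hz
        rw [hz, ENNReal.zero_rpow_of_pos hp0, zero_mul]
      rw [this, lintegral_zero, ENNReal.zero_rpow_of_pos (by positivity)]
    rw [h2, mul_zero, nonpos_iff_eq_zero, wkNorm, ENNReal.iSup_eq_zero] at h1
    have h3 := h1 y
    rw [mul_eq_zero, or_iff_right hy.ne', ENNReal.rpow_eq_zero_iff_of_pos (by positivity)] at h3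
    have h4 : volume {x | y < g x} = 0 := by simpa [wMeas] using h3
    have : wMeas u {x | y < g x} = 0 := setLIntegral_measure_zero _ _ h4
    rw [this]; exact zero_le
  have hF0 : ∀ z, maxOp F z ≠ 0 := by
    intro z hz
    apply hf0
    filter_upwards [maxOp_eq_zero hz hF] with w hw
    exact (ENNReal.rpow_eq_zero_iff_of_pos (by positivity)).1 hw
  set h : (Fin n → ℝ) → ℝ≥0∞ := Set.indicator {x | y < g x} u with hh
  have hhm : Measurable h := hu.1.indicator hSm
  set G : (Fin n → ℝ) → ℝ≥0∞ := fun z => h z ^ (1 / μ) with hGd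
  have hG : Measurable G := hhm.pow_const _
  have hMh : ∀ z, maxOpP μ h z = maxOp G z ^ μ := fun z => rfl
  have hwu : wMeas u {x | y < g x} = ∫⁻ z, h z := (lintegral_indicator hSm _).symm
  -- case `h = 0`
  by_cases hh0 : ∀ᵐ z, h z = 0
  · have : wMeas u {x | y < g x} = 0 := by
      rw [hwu, lintegral_congr_ae hh0]; simp
    rw [this]; exact zero_le
  have hG0 : ∀ z, maxOp G z ≠ 0 := by
    intro z hz
    apply hh0
    filter_upwards [maxOp_eq_zero hz hG] with w hw
    exact (ENNReal.rpow_eq_zero_iff_of_pos (by positivity)).1 hw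
  have hhle : ∀ᵐ z, h z ≤ maxOpP μ h z := by
    filter_upwards [ae_le_maxOp hG] with z hz
    have := ENNReal.rpow_le_rpow hz hμ0.le
    rwa [hGd, ← ENNReal.rpow_mul, one_div_mul_cancel hμ0.ne', ENNReal.rpow_one] at this
  have hfle : ∀ᵐ z, f z ≤ maxOpP r f z := by
    filter_upwards [ae_le_maxOp hF] with z hz
    have := ENNReal.rpow_le_rpow hz hr.le
    rwa [hFd, ← ENNReal.rpow_mul, one_div_mul_cancel hr.ne', ENNReal.rpow_one] at this
  set v : (Fin n → ℝ) → ℝ≥0∞ := fun z => maxOp G z ^ μ * (maxOp F z ^ δ) ^ (-s) with hv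
  have hv2 : ∀ z, v z = maxOpP μ h z * maxOpP r f z ^ (-α) := by
    intro z
    rw [hMh, hMf]
    simp only [hv]
    rw [← ENNReal.rpow_mul, ← ENNReal.rpow_mul]
    congr 2
    rw [mul_neg, hδs, mul_neg]
  have hvm : Measurable v := ((measurable_maxOp G).pow_const _).mul
    (((measurable_maxOp F).pow_const _).pow_const _)
  have hvA : ainfConst v ≤ a1C n μ * a1C n δ ^ s :=
    (iInf₂_le (s + 1) (by linarith)).trans (ap_bound hF hG hδ hδ1 hμ0 hμ1 hs0 hG0 hFt)
  have hH := H v hvm (lt_of_le_of_lt hvA hCt.lt_top)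
  have hH1 : y * (wMeas v {x | y < g x}) ^ (1 / p₀) ≤ K * stNorm p₀ v f :=
    (le_iSup (fun y => y * (wMeas v {x | y < g x}) ^ (1 / p₀)) y).trans
      (hH.trans (mul_le_mul_left (hK _ hvA) _))
  have hH2 : y ^ p₀ * wMeas v {x | y < g x} ≤ K ^ p₀ * ∫⁻ x, f x ^ p₀ * v x := by
    have := ENNReal.rpow_le_rpow hH1 hp0.le
    rwa [stNorm, ENNReal.mul_rpow_of_nonneg _ _ hp0.le, ENNReal.mul_rpow_of_nonneg _ _ hp0.le,
      ← ENNReal.rpow_mul, ← ENNReal.rpow_mul, one_div_mul_cancel hp0.ne', ENNReal.rpow_one,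
      ENNReal.rpow_one] at this
  have hint : ∫⁻ x, f x ^ p₀ * v x ≤ ∫⁻ x, f x ^ (p₀ - α) * maxOpP μ h x := by
    apply lintegral_mono_ae
    filter_upwards [hfle, hFt] with z hz hzt
    by_cases hfz : f z = 0
    · rw [hfz, ENNReal.zero_rpow_of_pos hp0, zero_mul]; exact zero_le
    have hfzt : f z ≠ ⊤ := by
      refine ne_top_of_le_ne_top ?_ hz
      rw [hMf]
      exact ENNReal.rpow_ne_top_of_nonneg hr.le hzt
    rw [hv2, mul_left_comm, mul_comm (f z ^ (p₀ - α)), sub_eq_add_neg,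
      ENNReal.rpow_add _ _ hfz hfzt]
    refine mul_le_mul_right (mul_le_mul_right ?_ _) _
    rw [ENNReal.rpow_neg, ENNReal.rpow_neg, ENNReal.inv_le_inv]
    exact ENNReal.rpow_le_rpow hz hα0
  have hMm : Measurable (maxOpP r f) := (measurable_maxOp F).pow_const _
  have hT : MeasurableSet {x | y < maxOpP r f x} := measurableSet_lt measurable_const hMm
  have hsplit : wMeas u {x | y < g x} ≤ wMeas u {x | y < maxOpP r f x} +
      y ^ α * wMeas v {x | y < g x} := by
    have hyα : y ^ α ≠ ⊤ := ENNReal.rpow_ne_top_of_nonneg hα0 hyt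
    have hyα0 : y ^ α ≠ 0 := by
      simp [ENNReal.rpow_eq_zero_iff, hy.ne', hyt]
    rw [hwu, wMeas, wMeas, ← lintegral_const_mul' _ _ hyα, ← lintegral_indicator hT,
      ← lintegral_indicator hSm, ← lintegral_add_left (hu.1.indicator hT)]
    apply lintegral_mono_ae
    filter_upwards [hhle] with z hz
    by_cases hzS : z ∈ {x | y < g x}
    swap
    · rw [hh, Set.indicator_of_notMem hzS]; exact zero_le
    by_cases hzT : z ∈ {x | y < maxOpP r f x}
    · rw [hh, Set.indicator_of_mem hzS, Set.indicator_of_mem hzT]; exact le_self_add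
    rw [Set.indicator_of_notMem hzT, Set.indicator_of_mem hzS, zero_add, hv2]
    have h1 : maxOpP r f z ≤ y := not_lt.1 hzT
    calc h z ≤ maxOpP μ h z := hz
      _ = y ^ α * (maxOpP μ h z * (y ^ α)⁻¹) := by
          rw [mul_left_comm, ENNReal.mul_inv_cancel hyα0 hyα, mul_one]
      _ ≤ _ := by
          gcongr
          rw [ENNReal.rpow_neg, ENNReal.inv_le_inv]
          exact ENNReal.rpow_le_rpow h1 hα0
  set J := ∫⁻ x, f x ^ (p₀ - α) * maxOpP μ h x with hJ
  have hfin : y ^ α * wMeas v {x | y < g x} ≤ K ^ p₀ * (y ^ (-(p₀ - α)) * J) := by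
    have e : y ^ α = y ^ (-(p₀ - α)) * y ^ p₀ := by
      rw [← ENNReal.rpow_add _ _ hy.ne' hyt]; congr 1; ring
    calc y ^ α * wMeas v {x | y < g x}
        = y ^ (-(p₀ - α)) * (y ^ p₀ * wMeas v {x | y < g x}) := by rw [e, mul_assoc]
      _ ≤ y ^ (-(p₀ - α)) * (K ^ p₀ * J) := by
          exact mul_le_mul_right (hH2.trans (mul_le_mul_right hint _)) _
      _ = _ := by ring
  refine hsplit.trans ((add_le_add_right hfin _).trans ?_)
  rw [mul_add]
  gcongr
  · exact le_mul_of_one_le_left (by positivity) le_self_add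
  · exact le_add_self

end
end

section
/- Let $f,g\ge0$ satisfy $\|g\|_{L^{p_0,\infty}(w)}\le\varphi(\|w\|_{A_\infty})\|f\|_{L^{p_0}(w)}$ for every $w\in A_\infty$, with $\varphi$ locally bounded. Then for every $0<p<\infty$ and every $w\in A_\infty$, $\|g\|_{L^{p,\infty}(w)}\le C_w\|f\|_{L^p(w)}$. -/
open MeasureTheory ENNReal Set

noncomputable section

/-- Doubling measures with positive finite balls. -/
def Dbl {n : ℕ} (ν : Measure (Fin n → ℝ)) (D : ℝ≥0∞) : Prop :=
  ∀ (c : Fin n → ℝ) (r : ℝ), 0 < r → ν (Metric.ball c r) ≠ 0 ∧ ν (Metric.ball c r) ≠ ⊤ ∧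
    ν (Metric.ball c (7 * r)) ≤ D * ν (Metric.ball c r)

/-- Maximal function over open balls with respect to `ν`. -/
def mf {n : ℕ} (ν : Measure (Fin n → ℝ)) (h : (Fin n → ℝ) → ℝ≥0∞) (x : Fin n → ℝ) : ℝ≥0∞ :=
  ⨆ (c : Fin n → ℝ) (r : ℝ) (_ : 0 < r ∧ x ∈ Metric.ball c r),
    (∫⁻ z in Metric.ball c r, h z ∂ν) / ν (Metric.ball c r)

lemma lt_mf_iff {n : ℕ} {ν : Measure (Fin n → ℝ)} {h : (Fin n → ℝ) → ℝ≥0∞} {x : Fin n → ℝ}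
    {l : ℝ≥0∞} : l < mf ν h x ↔ ∃ c r, 0 < r ∧ x ∈ Metric.ball c r ∧
      l < (∫⁻ z in Metric.ball c r, h z ∂ν) / ν (Metric.ball c r) := by
  simp [mf, lt_iSup_iff, and_assoc]

lemma le_mf {n : ℕ} {ν : Measure (Fin n → ℝ)} {h : (Fin n → ℝ) → ℝ≥0∞} {x : Fin n → ℝ}
    {c : Fin n → ℝ} {r : ℝ} (hr : 0 < r) (hx : x ∈ Metric.ball c r) :
    (∫⁻ z in Metric.ball c r, h z ∂ν) / ν (Metric.ball c r) ≤ mf ν h x := by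
  unfold mf
  exact le_iSup_of_le c (le_iSup_of_le r (le_iSup_of_le ⟨hr, hx⟩ le_rfl))

lemma measurable_mf {n : ℕ} (ν : Measure (Fin n → ℝ)) (h : (Fin n → ℝ) → ℝ≥0∞) :
    Measurable (mf ν h) := by
  apply measurable_of_Ioi
  intro l
  have : mf ν h ⁻¹' Ioi l = ⋃ (c : Fin n → ℝ) (r : ℝ) (_ : 0 < r ∧
      l < (∫⁻ z in Metric.ball c r, h z ∂ν) / ν (Metric.ball c r)), Metric.ball c r := by
    ext x
    simp only [mem_preimage, mem_Ioi, lt_mf_iff, mem_iUnion]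
    constructor
    · rintro ⟨c, r, h1, h2, h3⟩; exact ⟨c, r, ⟨h1, h3⟩, h2⟩
    · rintro ⟨c, r, ⟨h1, h3⟩, h2⟩; exact ⟨c, r, h1, h2, h3⟩
  rw [this]
  exact (isOpen_iUnion fun c => isOpen_iUnion fun r => isOpen_iUnion fun _ =>
    Metric.isOpen_ball).measurableSet

lemma weak_mf {n : ℕ} {ν : Measure (Fin n → ℝ)} {D : ℝ≥0∞} (hν : Dbl ν D)
    (h : (Fin n → ℝ) → ℝ≥0∞) (l : ℝ≥0∞) :
    l * ν {x | l < mf ν h x} ≤ D * ∫⁻ z, h z ∂ν := by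
  let S : ℕ → Set (Fin n → ℝ) := fun N => {x | ∃ (c : Fin n → ℝ) (r : ℝ), 0 < r ∧ r ≤ N ∧ x ∈ Metric.ball c r ∧
      l < (∫⁻ z in Metric.ball c r, h z ∂ν) / ν (Metric.ball c r)}
  have hS : {x | l < mf ν h x} = ⋃ N, S N := by
    ext x
    simp only [mem_ofPred_eq, lt_mf_iff, mem_iUnion, S]
    constructor
    · rintro ⟨c, r, h1, h2, h3⟩
      obtain ⟨N, hN⟩ := exists_nat_ge r
      exact ⟨N, c, r, h1, hN, h2, h3⟩
    · rintro ⟨N, c, r, h1, _, h2, h3⟩; exact ⟨c, r, h1, h2, h3⟩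
  have hmono : Monotone S := by
    rintro M N hMN x ⟨c, r, h1, h2, h3, h4⟩
    exact ⟨c, r, h1, h2.trans (by exact_mod_cast hMN), h3, h4⟩
  rw [hS, hmono.measure_iUnion, ENNReal.mul_iSup]
  refine iSup_le fun N => ?_
  let t : Set ((Fin n → ℝ) × ℝ) := {q | 0 < q.2 ∧ q.2 ≤ N ∧
      l < (∫⁻ z in Metric.ball q.1 q.2, h z ∂ν) / ν (Metric.ball q.1 q.2)}
  obtain ⟨u, hut, hdis, hcov⟩ := Vitali.exists_disjoint_subfamily_covering_enlargement_closedBall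
    t (fun q => q.1) (fun q => q.2) N (fun a ha => ha.2.1) 5 (by norm_num)
  have hdis' : u.PairwiseDisjoint fun a => Metric.ball a.1 a.2 :=
    hdis.mono fun _ => Metric.ball_subset_closedBall
  have hcount : u.Countable := hdis'.countable_of_isOpen (fun _ _ => Metric.isOpen_ball)
    (fun a ha => Metric.nonempty_ball.2 (hut ha).1)
  have hsub : S N ⊆ ⋃ a ∈ u, Metric.ball a.1 (7 * a.2) := by
    rintro x ⟨c, r, h1, h2, h3, h4⟩
    obtain ⟨b, hb, hb2⟩ := hcov (c, r) ⟨h1, h2, h4⟩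
    refine mem_iUnion₂.2 ⟨b, hb, ?_⟩
    have := hb2 (Metric.ball_subset_closedBall h3)
    have hb0 := (hut hb).1
    refine Metric.closedBall_subset_ball ?_ this
    linarith
  calc l * ν (S N) ≤ l * ∑' a : u, ν (Metric.ball a.1.1 (7 * a.1.2)) := by
        gcongr
        exact (measure_mono hsub).trans (measure_biUnion_le ν hcount _)
    _ = ∑' a : u, l * ν (Metric.ball a.1.1 (7 * a.1.2)) := by rw [ENNReal.tsum_mul_left]
    _ ≤ ∑' a : u, D * ∫⁻ z in Metric.ball a.1.1 a.1.2, h z ∂ν := by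
        refine ENNReal.tsum_le_tsum fun a => ?_
        obtain ⟨ha1, ha2, ha3⟩ := hut a.2
        obtain ⟨h1, h2, h3⟩ := hν a.1.1 a.1.2 ha1
        calc l * ν (Metric.ball a.1.1 (7 * a.1.2)) ≤ l * (D * ν (Metric.ball a.1.1 a.1.2)) := by
              gcongr
          _ = D * (l * ν (Metric.ball a.1.1 a.1.2)) := by ring
          _ ≤ _ := by
            gcongr
            exact (ENNReal.le_div_iff_mul_le (Or.inl h1) (Or.inl h2)).1 ha3.le
    _ = D * ∫⁻ z in ⋃ a ∈ u, Metric.ball a.1 a.2, h z ∂ν := by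
        rw [ENNReal.tsum_mul_left, lintegral_biUnion hcount
          (fun _ _ => measurableSet_ball) hdis']
    _ ≤ _ := by
        exact mul_le_mul_right (setLIntegral_le_lintegral _ _) _

lemma mf_pos {n : ℕ} {ν : Measure (Fin n → ℝ)} {D : ℝ≥0∞} (hν : Dbl ν D)
    (h : (Fin n → ℝ) → ℝ≥0∞) (hh : ∫⁻ z, h z ∂ν ≠ 0) (x : Fin n → ℝ) : mf ν h x ≠ 0 := by
  intro h0
  apply hh
  have hb : ∀ N : ℕ, ∫⁻ z in Metric.ball x (N + 1), h z ∂ν = 0 := by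
    intro N
    have hN : (0 : ℝ) < N + 1 := by positivity
    have := le_mf (ν := ν) (h := h) hN (Metric.mem_ball_self (x := x) hN)
    rw [h0, nonpos_iff_eq_zero, ENNReal.div_eq_zero_iff] at this
    exact this.resolve_right (hν x _ hN).2.1
  have hU : (⋃ N : ℕ, Metric.ball x ((N : ℝ) + 1)) = univ := by
    refine eq_univ_of_forall fun z => ?_
    obtain ⟨N, hN⟩ := exists_nat_ge (dist z x)
    exact mem_iUnion.2 ⟨N, by rw [Metric.mem_ball]; linarith⟩
  rw [← setLIntegral_univ, ← hU]
  refine le_antisymm ((lintegral_iUnion_le _ _).trans ?_) (zero_le)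
  simp [hb]

/-- The modified maximal function. -/
def nf {n : ℕ} (ν : Measure (Fin n → ℝ)) (h : (Fin n → ℝ) → ℝ≥0∞) (x : Fin n → ℝ) : ℝ≥0∞ :=
  max (h x) (mf ν h x)

lemma weak_nf {n : ℕ} {ν : Measure (Fin n → ℝ)} {D : ℝ≥0∞} (hν : Dbl ν D)
    (h : (Fin n → ℝ) → ℝ≥0∞) (hh : Measurable h) (l : ℝ≥0∞) :
    l * ν {x | l < nf ν h x} ≤ (D + 1) * ∫⁻ z, h z ∂ν := by
  have : {x | l < nf ν h x} ⊆ {x | l < mf ν h x} ∪ {x | l ≤ h x} := by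
    intro x hx
    rcases lt_max_iff.1 (show l < max (h x) (mf ν h x) from hx) with h1 | h1
    · exact Or.inr h1.le
    · exact Or.inl h1
  calc l * ν {x | l < nf ν h x} ≤ l * (ν {x | l < mf ν h x} + ν {x | l ≤ h x}) := by
        gcongr
        exact (measure_mono this).trans (measure_union_le _ _)
    _ = l * ν {x | l < mf ν h x} + l * ν {x | l ≤ h x} := by ring
    _ ≤ D * ∫⁻ z, h z ∂ν + ∫⁻ z, h z ∂ν := by
        exact add_le_add (weak_mf hν h l) (mul_meas_ge_le_lintegral hh l)
    _ = _ := by ring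

lemma measurable_nf {n : ℕ} (ν : Measure (Fin n → ℝ)) (h : (Fin n → ℝ) → ℝ≥0∞)
    (hh : Measurable h) : Measurable (nf ν h) := hh.max (measurable_mf ν h)

lemma two_rpow_sum {a : ℝ} (ha : a < 0) : ∑' k : ℕ, (2 : ℝ≥0∞) ^ (a * k) ≠ ⊤ := by
  have : ∀ k : ℕ, (2 : ℝ≥0∞) ^ (a * k) = ((2 : ℝ≥0∞) ^ a) ^ k := by
    intro k
    rw [ENNReal.rpow_mul, ENNReal.rpow_natCast]
  simp_rw [this]
  rw [ENNReal.tsum_geometric]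
  refine ENNReal.inv_ne_top.2 ?_
  have : (2 : ℝ≥0∞) ^ a < 1 := ENNReal.rpow_lt_one_of_one_lt_of_neg (by norm_num) ha
  exact (tsub_pos_of_lt this).ne'

/-- Dyadic pointwise bound, large values. -/
lemma dyadic_up {d : ℝ} (hd : 0 < d) (G : ℝ≥0∞) :
    G ^ d ≤ 1 + ∑' k : ℕ, (2 : ℝ≥0∞) ^ (d * (k + 1)) *
      ({z : ℝ≥0∞ | (2 : ℝ≥0∞) ^ (k : ℝ) < z}.indicator 1 G) := by
  by_cases h1 : G ≤ 1
  · calc G ^ d ≤ 1 := ENNReal.rpow_le_one h1 hd.le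
      _ ≤ _ := le_self_add
  push Not at h1
  by_cases hG : G = ⊤
  · have : (∑' k : ℕ, (2 : ℝ≥0∞) ^ (d * (k + 1)) *
      ({z : ℝ≥0∞ | (2 : ℝ≥0∞) ^ (k : ℝ) < z}.indicator 1 G)) = ⊤ := by
      rw [eq_top_iff, ← ENNReal.tsum_const_eq_top_of_ne_zero (α := ℕ) one_ne_zero]
      refine ENNReal.tsum_le_tsum fun k => ?_
      have hm : G ∈ {z : ℝ≥0∞ | (2 : ℝ≥0∞) ^ (k : ℝ) < z} := by
        rw [hG, mem_ofPred_eq]; exact ENNReal.rpow_lt_top_of_nonneg (by positivity) (by simp)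
      rw [indicator_of_mem hm, Pi.one_apply, mul_one]
      exact ENNReal.one_le_rpow (by norm_num) (by positivity)
    rw [this]; simp
  obtain ⟨m, hm1, hm2⟩ := ENNReal.exists_mem_Ioc_zpow (x := G) (y := 2) (by positivity) hG
    (by norm_num) (by norm_num)
  have hm : 0 ≤ m := by
    by_contra hneg
    have : (2 : ℝ≥0∞) ^ (m + 1) ≤ 2 ^ (0 : ℤ) := ENNReal.zpow_le_of_le (by norm_num) (by omega)
    rw [zpow_zero] at this
    exact absurd (h1.trans_le hm2) (not_lt.2 this)
  obtain ⟨k, rfl⟩ := Int.eq_ofNat_of_zero_le hm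
  have e1 : (2 : ℝ≥0∞) ^ (k : ℝ) < G := by
    rw [ENNReal.rpow_natCast]; simpa using hm1
  have e2 : G ≤ (2 : ℝ≥0∞) ^ ((k : ℝ) + 1) := by
    have : ((k : ℝ) + 1) = ((k + 1 : ℕ) : ℝ) := by push_cast; ring
    rw [this, ENNReal.rpow_natCast]
    exact_mod_cast hm2
  refine le_trans ?_ (le_add_self.trans' (ENNReal.le_tsum k))
  rw [indicator_of_mem (by exact e1), Pi.one_apply, mul_one, mul_comm d, ENNReal.rpow_mul]
  exact ENNReal.rpow_le_rpow e2 hd.le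

/-- Dyadic pointwise bound, small values. -/
lemma dyadic_down {d : ℝ} (hd : 0 < d) (G : ℝ≥0∞) (hG : G ≤ 1) :
    G ^ d ≤ ∑' k : ℕ, (2 : ℝ≥0∞) ^ (-d * k) *
      ({z : ℝ≥0∞ | (2 : ℝ≥0∞) ^ (-((k : ℝ) + 1)) < z}.indicator 1 G) := by
  by_cases h0 : G = 0
  · simp [h0, hd]
  obtain ⟨m, hm1, hm2⟩ := ENNReal.exists_mem_Ioc_zpow (x := G) (y := 2) h0
    (hG.trans_lt (by simp)).ne (by norm_num) (by norm_num)
  have hm : m + 1 ≤ 0 := by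
    by_contra hneg
    have : (2 : ℝ≥0∞) ^ (0 : ℤ) ≤ 2 ^ m := ENNReal.zpow_le_of_le (by norm_num) (by omega)
    rw [zpow_zero] at this
    exact absurd (this.trans_lt hm1) (not_lt.2 hG)
  obtain ⟨k, hk⟩ := Int.eq_ofNat_of_zero_le (show 0 ≤ -(m + 1) by omega)
  have hmk : m = -((k : ℤ) + 1) := by omega
  subst hmk
  have e1 : (2 : ℝ≥0∞) ^ (-((k : ℝ) + 1)) < G := by
    rw [← ENNReal.rpow_intCast] at hm1
    push_cast at hm1
    exact hm1
  have e2 : G ≤ (2 : ℝ≥0∞) ^ (-(k : ℝ)) := by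
    rw [← ENNReal.rpow_intCast] at hm2
    have e : ((-((k : ℤ) + 1) + 1 : ℤ) : ℝ) = -(k : ℝ) := by push_cast; ring
    rwa [e] at hm2
  refine le_trans ?_ (ENNReal.le_tsum k)
  rw [indicator_of_mem (by exact e1), Pi.one_apply, mul_one,
    show -d * (k : ℝ) = -(k : ℝ) * d by ring, ENNReal.rpow_mul]
  exact ENNReal.rpow_le_rpow e2 hd.le

end

noncomputable section

/-- Constant in Kolmogorov's inequality. -/
def CK (d : ℝ) (A : ℝ≥0∞) : ℝ≥0∞ := 1 + A * (2 ^ d * ∑' k : ℕ, (2 : ℝ≥0∞) ^ ((d - 1) * k))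

lemma CK_ne_top {d : ℝ} (hd : 0 < d) (hd1 : d < 1) {A : ℝ≥0∞} (hA : A ≠ ⊤) : CK d A ≠ ⊤ := by
  unfold CK
  refine ENNReal.add_ne_top.2 ⟨by simp, ENNReal.mul_ne_top hA (ENNReal.mul_ne_top ?_ ?_)⟩
  · exact ENNReal.rpow_ne_top_of_nonneg hd.le (by simp)
  · exact two_rpow_sum (by linarith)

lemma kolm {n : ℕ} {ν : Measure (Fin n → ℝ)} {F : (Fin n → ℝ) → ℝ≥0∞} (hF : Measurable F)
    (Q : Set (Fin n → ℝ)) {A L : ℝ≥0∞} (hL : L ≠ 0) (hL' : L ≠ ⊤) {d : ℝ} (hd : 0 < d)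
    (hw : ∀ l, l * ν {x | l < F x} ≤ A * L * ν Q) :
    ∫⁻ x in Q, F x ^ d ∂ν ≤ CK d A * L ^ d * ν Q := by
  have hpt : ∀ x, F x ^ d ≤ L ^ d * (1 + ∑' k : ℕ, (2 : ℝ≥0∞) ^ (d * (k + 1)) *
      ({x | (2 : ℝ≥0∞) ^ (k : ℝ) * L < F x}.indicator 1 x)) := by
    intro x
    have h1 : F x = L * (F x / L) := (ENNReal.mul_div_cancel hL hL').symm
    conv_lhs => rw [h1, ENNReal.mul_rpow_of_nonneg _ _ hd.le]
    refine mul_le_mul_right ((dyadic_up hd _).trans ?_) _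
    refine add_le_add le_rfl (ENNReal.tsum_le_tsum fun k => mul_le_mul_right ?_ _)
    by_cases hk : (2 : ℝ≥0∞) ^ (k : ℝ) < F x / L
    · rw [indicator_of_mem (by exact hk), indicator_of_mem]
      · rfl
      · exact (ENNReal.lt_div_iff_mul_lt (Or.inl hL) (Or.inl hL')).1 hk
    · rw [indicator_of_notMem (by exact hk)]; exact zero_le
  have hms : ∀ k : ℕ, MeasurableSet {x | (2 : ℝ≥0∞) ^ (k : ℝ) * L < F x} := fun k =>
    measurableSet_lt measurable_const hF
  have hm : ∀ k : ℕ, Measurable fun x => (2 : ℝ≥0∞) ^ (d * (k + 1)) *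
      ({x | (2 : ℝ≥0∞) ^ (k : ℝ) * L < F x}.indicator 1 x) := fun k =>
    ((measurable_one.indicator (hms k))).const_mul _
  calc ∫⁻ x in Q, F x ^ d ∂ν ≤ ∫⁻ x in Q, L ^ d * (1 + ∑' k : ℕ, (2 : ℝ≥0∞) ^ (d * (k + 1)) *
      ({x | (2 : ℝ≥0∞) ^ (k : ℝ) * L < F x}.indicator 1 x)) ∂ν := lintegral_mono hpt
    _ = L ^ d * (ν Q + ∑' k : ℕ, (2 : ℝ≥0∞) ^ (d * (k + 1)) *
        ν.restrict Q {x | (2 : ℝ≥0∞) ^ (k : ℝ) * L < F x}) := by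
      rw [lintegral_const_mul, lintegral_add_left measurable_const, lintegral_tsum]
      · congr 2
        · simp
        · congr 1; ext k
          rw [lintegral_const_mul _ (measurable_one.indicator (hms k)), lintegral_indicator_one (hms k)]
      · exact fun k => (hm k).aemeasurable
      · exact measurable_const.add (Measurable.tsum hm)
    _ ≤ L ^ d * (ν Q + ∑' k : ℕ, (A * ν Q * 2 ^ d) * (2 : ℝ≥0∞) ^ ((d - 1) * k)) := by
      refine mul_le_mul_right (add_le_add le_rfl (ENNReal.tsum_le_tsum fun k => ?_)) _
      have h2 := hw ((2 : ℝ≥0∞) ^ (k : ℝ) * L)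
      have h20 : (2 : ℝ≥0∞) ^ (k : ℝ) ≠ 0 := by simp
      have h2t : (2 : ℝ≥0∞) ^ (k : ℝ) ≠ ⊤ := by simp
      have h3 : ν {x | (2 : ℝ≥0∞) ^ (k : ℝ) * L < F x} ≤ A * ν Q * (2 : ℝ≥0∞) ^ (-(k : ℝ)) := by
        rw [ENNReal.rpow_neg, ← div_eq_mul_inv, ENNReal.le_div_iff_mul_le (Or.inl h20) (Or.inl h2t)]
        refine (ENNReal.mul_le_mul_iff_right hL hL').1 ?_
        calc _ = (2 : ℝ≥0∞) ^ (k : ℝ) * L * ν {x | (2 : ℝ≥0∞) ^ (k : ℝ) * L < F x} := by ring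
          _ ≤ _ := h2
          _ = _ := by ring
      calc (2 : ℝ≥0∞) ^ (d * (k + 1)) * ν.restrict Q {x | (2 : ℝ≥0∞) ^ (k : ℝ) * L < F x}
          ≤ (2 : ℝ≥0∞) ^ (d * (k + 1)) * (A * ν Q * (2 : ℝ≥0∞) ^ (-(k : ℝ))) := by
            gcongr
            exact (Measure.restrict_apply_le _ _).trans h3
        _ = A * ν Q * ((2 : ℝ≥0∞) ^ (d * (k + 1)) * (2 : ℝ≥0∞) ^ (-(k : ℝ))) := by ring
        _ = A * ν Q * ((2 : ℝ≥0∞) ^ d * (2 : ℝ≥0∞) ^ ((d - 1) * k)) := by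
            rw [← ENNReal.rpow_add _ _ (by simp) (by simp),
              ← ENNReal.rpow_add _ _ (by simp) (by simp)]
            congr 2; ring
        _ = _ := by ring
    _ = _ := by
      rw [ENNReal.tsum_mul_left, CK]; ring

/-- Constant in the restricted strong type bound. -/
def CS (a : ℝ) : ℝ≥0∞ := 2 * ∑' k : ℕ, (2 : ℝ≥0∞) ^ ((1 - a) * k)

lemma CS_ne_top {a : ℝ} (ha : 1 < a) : CS a ≠ ⊤ :=
  ENNReal.mul_ne_top (by simp) (two_rpow_sum (by linarith))

lemma strong_le_one {n : ℕ} {ν : Measure (Fin n → ℝ)} {F : (Fin n → ℝ) → ℝ≥0∞}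
    (hF : Measurable F) (hF1 : ∀ x, F x ≤ 1) {B : ℝ≥0∞} {a : ℝ} (ha : 0 < a)
    (hw : ∀ l, l * ν {x | l < F x} ≤ B) :
    ∫⁻ x, F x ^ a ∂ν ≤ CS a * B := by
  have hms : ∀ k : ℕ, MeasurableSet {x | (2 : ℝ≥0∞) ^ (-((k : ℝ) + 1)) < F x} := fun k =>
    measurableSet_lt measurable_const hF
  calc ∫⁻ x, F x ^ a ∂ν ≤ ∫⁻ x, ∑' k : ℕ, (2 : ℝ≥0∞) ^ (-a * k) *
      ({x | (2 : ℝ≥0∞) ^ (-((k : ℝ) + 1)) < F x}.indicator 1 x) ∂ν :=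
        lintegral_mono fun x => dyadic_down ha _ (hF1 x)
    _ = ∑' k : ℕ, (2 : ℝ≥0∞) ^ (-a * k) * ν {x | (2 : ℝ≥0∞) ^ (-((k : ℝ) + 1)) < F x} := by
      rw [lintegral_tsum]
      · congr 1; ext k
        rw [lintegral_const_mul _ (measurable_one.indicator (hms k)), lintegral_indicator_one (hms k)]
      · exact fun k => ((measurable_one.indicator (hms k)).const_mul _).aemeasurable
    _ ≤ ∑' k : ℕ, (2 * B) * (2 : ℝ≥0∞) ^ ((1 - a) * k) := by
      refine ENNReal.tsum_le_tsum fun k => ?_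
      have h2 := hw ((2 : ℝ≥0∞) ^ (-((k : ℝ) + 1)))
      have h3 : ν {x | (2 : ℝ≥0∞) ^ (-((k : ℝ) + 1)) < F x} ≤ (2 : ℝ≥0∞) ^ ((k : ℝ) + 1) * B := by
        calc _ = (2 : ℝ≥0∞) ^ ((k : ℝ) + 1) * ((2 : ℝ≥0∞) ^ (-((k : ℝ) + 1)) *
                ν {x | (2 : ℝ≥0∞) ^ (-((k : ℝ) + 1)) < F x}) := by
              rw [← mul_assoc, ← ENNReal.rpow_add _ _ (by simp) (by simp)]; simp
          _ ≤ _ := by gcongr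
      calc _ ≤ (2 : ℝ≥0∞) ^ (-a * k) * ((2 : ℝ≥0∞) ^ ((k : ℝ) + 1) * B) := by gcongr
        _ = ((2 : ℝ≥0∞) ^ (-a * k) * (2 : ℝ≥0∞) ^ ((k : ℝ) + 1)) * B := by ring
        _ = (2 ^ (1 : ℝ) * (2 : ℝ≥0∞) ^ ((1 - a) * k)) * B := by
            rw [← ENNReal.rpow_add _ _ (by simp) (by simp),
              ← ENNReal.rpow_add _ _ (by simp) (by simp)]
            congr 2; ring
        _ = _ := by rw [ENNReal.rpow_one]; ring
    _ = _ := by rw [ENNReal.tsum_mul_left, CS]; ring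

/-- The `A_1(ν)` constant of powers of the maximal function. -/
def CA (d : ℝ) (D : ℝ≥0∞) : ℝ≥0∞ := CK d ((D + 1) * D) + D ^ d

lemma CA_ne_top {d : ℝ} (hd : 0 < d) (hd1 : d < 1) {D : ℝ≥0∞} (hD : D ≠ ⊤) : CA d D ≠ ⊤ := by
  refine ENNReal.add_ne_top.2 ⟨CK_ne_top hd hd1 ?_, ENNReal.rpow_ne_top_of_nonneg hd.le hD⟩
  exact ENNReal.mul_ne_top (ENNReal.add_ne_top.2 ⟨hD, by simp⟩) hD

lemma CA_ne_zero (d : ℝ) (D : ℝ≥0∞) : CA d D ≠ 0 := by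
  simp [CA, CK]

lemma a1_nf {n : ℕ} {ν : Measure (Fin n → ℝ)} {D : ℝ≥0∞} (hν : Dbl ν D)
    {h : (Fin n → ℝ) → ℝ≥0∞} (hh : Measurable h) (h0 : ∫⁻ z, h z ∂ν ≠ 0) {d : ℝ} (hd : 0 < d)
    (c : Fin n → ℝ) {r : ℝ} (hr : 0 < r) {z : Fin n → ℝ} (hz : z ∈ Metric.closedBall c r) :
    ∫⁻ x in Metric.closedBall c r, nf ν h x ^ d ∂ν ≤
      CA d D * nf ν h z ^ d * ν (Metric.closedBall c r) := by
  set Q := Metric.closedBall c r with hQ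
  set L := mf ν h z with hL
  have hL0 : L ≠ 0 := mf_pos hν h h0 z
  have hbQ : ν (Metric.ball c r) ≤ ν Q := measure_mono Metric.ball_subset_closedBall
  obtain ⟨hb0, hbt, hbD⟩ := hν c r hr
  have hQ0 : ν Q ≠ 0 := fun hq => hb0 (le_antisymm (hq ▸ hbQ) zero_le)
  have hLn : L ≤ nf ν h z := le_max_right _ _
  by_cases hLt : L = ⊤
  · have : nf ν h z = ⊤ := by rw [hLt] at hLn; exact top_le_iff.1 hLn
    rw [this, ENNReal.top_rpow_of_pos hd, ENNReal.mul_top (CA_ne_zero d D), ENNReal.top_mul hQ0]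
    exact le_top
  set B := Metric.ball c (5 * r) with hB
  set h1 := B.indicator h with hh1
  have hh1m : Measurable h1 := hh.indicator measurableSet_ball
  have hQB : Q ⊆ B := Metric.closedBall_subset_ball (by linarith)
  have hBint : ∫⁻ x, h1 x ∂ν ≤ D * L * ν Q := by
    rw [lintegral_indicator measurableSet_ball]
    have h5 : (0 : ℝ) < 5 * r := by linarith
    obtain ⟨g1, g2, _⟩ := hν c (5 * r) h5
    have := (ENNReal.div_le_iff_le_mul (Or.inl g1) (Or.inl g2)).1
      (le_mf (ν := ν) (h := h) h5 (hQB hz))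
    calc _ ≤ L * ν B := this
      _ ≤ L * (D * ν Q) := by
        gcongr
        refine (measure_mono (Metric.ball_subset_ball ?_)).trans (hbD.trans ?_)
        · linarith
        · gcongr
      _ = _ := by ring
  have hw : ∀ l, l * ν {x | l < nf ν h1 x} ≤ ((D + 1) * D) * L * ν Q := by
    intro l
    calc _ ≤ (D + 1) * ∫⁻ x, h1 x ∂ν := weak_nf hν h1 hh1m l
      _ ≤ (D + 1) * (D * L * ν Q) := by gcongr
      _ = _ := by ring
  have hK := kolm (measurable_nf ν h1 hh1m) Q hL0 hLt hd hw
  have hpt : ∀ x ∈ Q, nf ν h x ≤ max (nf ν h1 x) (D * L) := by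
    intro x hx
    refine max_le ?_ ?_
    · have : h x = h1 x := (indicator_of_mem (hQB hx) h).symm
      rw [this]
      exact (le_max_left _ _).trans (le_max_left _ _)
    · refine iSup_le fun c' => iSup_le fun R => iSup_le fun ⟨hR, hxR⟩ => ?_
      by_cases hsub : Metric.ball c' R ⊆ B
      · refine le_max_of_le_left (le_max_of_le_right ?_)
        refine le_trans (le_of_eq ?_) (le_mf hR hxR)
        congr 1
        exact setLIntegral_congr_fun measurableSet_ball
          (fun y hy => (indicator_of_mem (hsub hy) h).symm)
      · refine le_max_of_le_right ?_
        obtain ⟨y, hy, hyB⟩ := not_subset.1 hsub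
        have e1 : 5 * r ≤ dist y c := not_lt.1 hyB
        have e2 : dist y c' < R := hy
        have e3 : dist x c' < R := hxR
        have e4 : dist x c ≤ r := hx
        have e5 : dist z c ≤ r := hz
        have e6 : dist y c ≤ dist y c' + dist c' x + dist x c := dist_triangle4 _ _ _ _
        have e7 : dist z c' ≤ dist z c + dist c x + dist x c' := dist_triangle4 _ _ _ _
        rw [dist_comm c' x] at e6
        rw [dist_comm c x] at e7
        have hz7 : z ∈ Metric.ball c' (7 * R) := by
          rw [Metric.mem_ball]; linarith
        obtain ⟨g1, g2, g3⟩ := hν c' R hR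
        obtain ⟨k1, k2, _⟩ := hν c' (7 * R) (by linarith)
        rw [ENNReal.div_le_iff_le_mul (Or.inl g1) (Or.inl g2)]
        calc ∫⁻ y in Metric.ball c' R, h y ∂ν ≤ ∫⁻ y in Metric.ball c' (7 * R), h y ∂ν :=
              lintegral_mono_set (Metric.ball_subset_ball (by linarith))
          _ ≤ L * ν (Metric.ball c' (7 * R)) :=
              (ENNReal.div_le_iff_le_mul (Or.inl k1) (Or.inl k2)).1
                (le_mf (ν := ν) (h := h) (by linarith) hz7)
          _ ≤ L * (D * ν (Metric.ball c' R)) := by gcongr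
          _ = _ := by ring
  calc ∫⁻ x in Q, nf ν h x ^ d ∂ν ≤ ∫⁻ x in Q, (nf ν h1 x ^ d + (D * L) ^ d) ∂ν := by
        refine setLIntegral_mono' measurableSet_closedBall fun x hx => ?_
        refine (ENNReal.rpow_le_rpow (hpt x hx) hd.le).trans ?_
        rcases max_choice (nf ν h1 x) (D * L) with e | e <;> rw [e]
        · exact le_self_add
        · exact le_add_self
    _ = ∫⁻ x in Q, nf ν h1 x ^ d ∂ν + (D * L) ^ d * ν Q := by
        rw [lintegral_add_right _ measurable_const]; simp
    _ ≤ CK d ((D + 1) * D) * L ^ d * ν Q + (D * L) ^ d * ν Q := by gcongr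
    _ = CA d D * L ^ d * ν Q := by
        rw [CA, ENNReal.mul_rpow_of_nonneg _ _ hd.le]; ring
    _ ≤ _ := by gcongr

end

noncomputable section

lemma isCube_closedBall {n : ℕ} (c : Fin n → ℝ) {r : ℝ} (hr : 0 < r) :
    IsCube (Metric.closedBall c r) := by
  refine ⟨fun i => c i - r, 2 * r, by linarith, ?_⟩
  ext x
  rw [Metric.mem_closedBall, dist_pi_le_iff hr.le]
  simp only [Set.mem_Icc, Pi.le_def, Real.dist_eq, abs_le]
  constructor
  · intro h; exact ⟨fun i => by linarith [(h i).1], fun i => by linarith [(h i).2]⟩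
  · intro h i; exact ⟨by linarith [h.1 i], by linarith [h.2 i]⟩

lemma IsCube.eq_closedBall {n : ℕ} {Q : Set (Fin n → ℝ)} (h : IsCube Q) :
    ∃ c r, 0 < r ∧ Q = Metric.closedBall c r := by
  obtain ⟨a, r, hr, rfl⟩ := h
  refine ⟨fun i => a i + r / 2, r / 2, by linarith, ?_⟩
  ext x
  rw [Metric.mem_closedBall, dist_pi_le_iff (by linarith)]
  simp only [Set.mem_Icc, Pi.le_def, Real.dist_eq, abs_le]
  constructor
  · intro h i; exact ⟨by linarith [h.1 i], by linarith [h.2 i]⟩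
  · intro h; exact ⟨fun i => by linarith [(h i).1], fun i => by linarith [(h i).2]⟩

lemma vol_pos_s8 {n : ℕ} (c : Fin n → ℝ) {r : ℝ} (hr : 0 < r) :
    volume (Metric.closedBall c r) ≠ 0 := (Metric.measure_closedBall_pos volume c hr).ne'

lemma vol_fin {n : ℕ} (c : Fin n → ℝ) (r : ℝ) :
    volume (Metric.closedBall c r) ≠ ⊤ := measure_closedBall_lt_top.ne

lemma cubeAvg_eq {n : ℕ} (f : (Fin n → ℝ) → ℝ≥0∞) (Q : Set (Fin n → ℝ)) :
    cubeAvg f Q = ∫⁻ x, f x ∂((volume Q)⁻¹ • volume.restrict Q) := by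
  rw [lintegral_smul_measure, cubeAvg, div_eq_mul_inv, mul_comm]; rfl

lemma cubeAvg_holder {n : ℕ} {f g : (Fin n → ℝ) → ℝ≥0∞} (hf : Measurable f) (hg : Measurable g)
    {a b : ℝ} (ha : 0 ≤ a) (hb : 0 ≤ b) (hab : a + b = 1) (Q : Set (Fin n → ℝ)) :
    cubeAvg (fun x => f x ^ a * g x ^ b) Q ≤ cubeAvg f Q ^ a * cubeAvg g Q ^ b := by
  simp only [cubeAvg_eq]
  exact ENNReal.lintegral_mul_norm_pow_le hf.aemeasurable hg.aemeasurable ha hb hab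

lemma cubeAvg_mono_ae {n : ℕ} {f g : (Fin n → ℝ) → ℝ≥0∞} {Q : Set (Fin n → ℝ)}
    (h : ∀ᵐ x ∂(volume.restrict Q), f x ≤ g x) : cubeAvg f Q ≤ cubeAvg g Q :=
  ENNReal.div_le_div_right (lintegral_mono_ae h) _

lemma ae_of_balls {n : ℕ} {P : (Fin n → ℝ) → Prop} (c : Fin n → ℝ) (r : ℝ)
    (h : ∀ N : ℕ, ∀ᵐ x ∂(volume.restrict (Metric.closedBall c (r + N))), P x) : ∀ᵐ x, P x := by
  have hU : (⋃ N : ℕ, Metric.closedBall c (r + N)) = univ := by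
    refine eq_univ_of_forall fun z => ?_
    obtain ⟨N, hN⟩ := exists_nat_ge (dist z c - r)
    exact mem_iUnion.2 ⟨N, by rw [Metric.mem_closedBall]; linarith⟩
  have := (ae_restrict_iUnion_iff (fun N : ℕ => Metric.closedBall c (r + N)) P).2 h
  rwa [hU, Measure.restrict_univ] at this

/-- Nondegenerate `A_s` weight with constant at most `T`. -/
structure GoodW {n : ℕ} (s : ℝ) (T : ℝ≥0∞) (w : (Fin n → ℝ) → ℝ≥0∞) : Prop where
  meas : Measurable w
  hs : 1 < s
  ap : ∀ (c : Fin n → ℝ) (r : ℝ), 0 < r → cubeAvg w (Metric.closedBall c r) *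
    (cubeAvg (fun x => w x ^ (-1 / (s - 1))) (Metric.closedBall c r)) ^ (s - 1) ≤ T
  pos : ∀ (c : Fin n → ℝ) (r : ℝ), 0 < r → ∫⁻ x in Metric.closedBall c r, w x ≠ 0
  fin : ∀ (c : Fin n → ℝ) (r : ℝ), 0 < r → ∫⁻ x in Metric.closedBall c r, w x ≠ ⊤
  ae : ∀ᵐ x : Fin n → ℝ, w x ≠ 0 ∧ w x ≠ ⊤

lemma goodW_of {n : ℕ} {s : ℝ} (hs : 1 < s) {T : ℝ≥0∞} (hT : T ≠ ⊤) {w : (Fin n → ℝ) → ℝ≥0∞}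
    (hw : Measurable w) (hap : apConst s w ≤ T) (h0 : ¬ ∀ᵐ x, w x = 0) (ht : ¬ ∀ᵐ x, w x = ⊤) :
    GoodW s T w := by
  have hs0 : 0 < s - 1 := by linarith
  have hneg : -1 / (s - 1) < 0 := div_neg_of_neg_of_pos (by norm_num) hs0
  have hm : Measurable fun x => w x ^ (-1 / (s - 1)) := hw.pow_const _
  have ap : ∀ (c : Fin n → ℝ) (r : ℝ), 0 < r → cubeAvg w (Metric.closedBall c r) *
    (cubeAvg (fun x => w x ^ (-1 / (s - 1))) (Metric.closedBall c r)) ^ (s - 1) ≤ T := by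
    intro c r hr
    refine le_trans ?_ hap
    rw [apConst, if_neg hs.ne']
    exact le_iSup₂_of_le (Metric.closedBall c r) (isCube_closedBall c hr) le_rfl
  have hfin : ∀ (c : Fin n → ℝ) (r : ℝ), 0 < r → ∫⁻ x in Metric.closedBall c r, w x ≠ ⊤ := by
    intro c r hr htop
    refine ht (ae_of_balls c r fun N => ?_)
    have hrN : 0 < r + N := by positivity
    have h1 : ∫⁻ x in Metric.closedBall c (r + N), w x = ⊤ := by
      rw [eq_top_iff, ← htop]
      exact lintegral_mono_set (Metric.closedBall_subset_closedBall (by simp))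
    have h2 := ap c (r + N) hrN
    rw [cubeAvg, h1, ENNReal.top_div_of_ne_top (vol_fin _ _)] at h2
    have h3 : cubeAvg (fun x => w x ^ (-1 / (s - 1))) (Metric.closedBall c (r + N)) = 0 := by
      by_contra hne
      have hne' : cubeAvg (fun x => w x ^ (-1 / (s - 1))) (Metric.closedBall c (r + N)) ^ (s - 1)
        ≠ 0 := by simp [ENNReal.rpow_eq_zero_iff, hne, hs0.not_gt]
      rw [ENNReal.top_mul hne'] at h2
      exact hT (top_le_iff.1 h2)
    rw [cubeAvg, ENNReal.div_eq_zero_iff] at h3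
    have h4 := (lintegral_eq_zero_iff hm).1 (h3.resolve_right (vol_fin _ _))
    filter_upwards [h4] with x hx
    simp only [Pi.zero_apply, ENNReal.rpow_eq_zero_iff] at hx
    rcases hx with hx | hx
    · linarith [hx.2]
    · exact hx.1
  have hI : ∀ (c : Fin n → ℝ) (r : ℝ), 0 < r → ∫⁻ x in Metric.closedBall c r, w x ≠ 0 →
      ∫⁻ x in Metric.closedBall c r, w x ^ (-1 / (s - 1)) ≠ ⊤ := by
    intro c r hr hne htop
    have h2 := ap c r hr
    have e1 : cubeAvg w (Metric.closedBall c r) ≠ 0 := by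
      rw [cubeAvg, Ne, ENNReal.div_eq_zero_iff]; push Not; exact ⟨hne, vol_fin _ _⟩
    have e2 : cubeAvg (fun x => w x ^ (-1 / (s - 1))) (Metric.closedBall c r) = ⊤ := by
      rw [cubeAvg, htop, ENNReal.top_div_of_ne_top (vol_fin _ _)]
    rw [e2, ENNReal.top_rpow_of_pos hs0, ENNReal.mul_top e1] at h2
    exact hT (top_le_iff.1 h2)
  have hpos : ∀ (c : Fin n → ℝ) (r : ℝ), 0 < r → ∫⁻ x in Metric.closedBall c r, w x ≠ 0 := by
    intro c r hr hz
    refine h0 (ae_of_balls c r fun N => ?_)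
    have hrN : 0 < r + N := by positivity
    suffices ∫⁻ x in Metric.closedBall c (r + N), w x = 0 from (lintegral_eq_zero_iff hw).1 this
    by_contra hne
    refine hI c _ hrN hne ?_
    rw [eq_top_iff]
    have h1 : ∫⁻ x in Metric.closedBall c r, w x ^ (-1 / (s - 1)) = ⊤ := by
      have : ∫⁻ x in Metric.closedBall c r, w x ^ (-1 / (s - 1)) =
          ∫⁻ x in Metric.closedBall c r, ⊤ := by
        refine lintegral_congr_ae ?_
        filter_upwards [(lintegral_eq_zero_iff hw).1 hz] with x hx
        rw [hx, Pi.zero_apply, ENNReal.zero_rpow_of_neg hneg]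
      rw [this, lintegral_const, Measure.restrict_apply_univ, ENNReal.top_mul (vol_pos_s8 c hr)]
    rw [← h1]
    exact lintegral_mono_set (Metric.closedBall_subset_closedBall (by simp))
  refine ⟨hw, hs, ap, hpos, hfin, ?_⟩
  refine ae_of_balls 0 1 fun N => ?_
  have hN : (0 : ℝ) < 1 + N := by positivity
  filter_upwards [ae_lt_top hw (hfin 0 _ hN), ae_lt_top hm (hI 0 _ hN (hpos 0 _ hN))] with x h1 h2
  refine ⟨fun hx => ?_, h1.ne⟩
  rw [hx, ENNReal.zero_rpow_of_neg hneg] at h2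
  exact lt_irrefl _ h2

lemma GoodW.avg_ne {n : ℕ} {s : ℝ} {T : ℝ≥0∞} {w : (Fin n → ℝ) → ℝ≥0∞} (h : GoodW s T w)
    (c : Fin n → ℝ) {r : ℝ} (hr : 0 < r) : cubeAvg w (Metric.closedBall c r) ≠ 0 ∧
      cubeAvg w (Metric.closedBall c r) ≠ ⊤ := by
  constructor
  · rw [cubeAvg, Ne, ENNReal.div_eq_zero_iff]; push Not; exact ⟨h.pos c r hr, vol_fin _ _⟩
  · exact ENNReal.div_ne_top (h.fin c r hr) (vol_pos_s8 c hr)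

lemma GoodW.holder {n : ℕ} {s : ℝ} {T : ℝ≥0∞} {w : (Fin n → ℝ) → ℝ≥0∞} (h : GoodW s T w)
    {f : (Fin n → ℝ) → ℝ≥0∞} (hf : Measurable f) (Q : Set (Fin n → ℝ)) :
    cubeAvg (fun x => f x ^ (1 / s)) Q ^ s ≤ cubeAvg (fun x => f x * w x) Q *
      cubeAvg (fun x => w x ^ (-1 / (s - 1))) Q ^ (s - 1) := by
  have hs := h.hs
  have hs0 : 0 < s - 1 := by linarith
  have hsp : 0 < s := by linarith
  have h1 : cubeAvg (fun x => f x ^ (1 / s)) Q ≤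
      cubeAvg (fun x => (f x * w x) ^ (1 / s) * (w x ^ (-1 / (s - 1))) ^ ((s - 1) / s)) Q := by
    refine cubeAvg_mono_ae (ae_restrict_of_ae ?_)
    filter_upwards [h.ae] with x hx
    rw [ENNReal.mul_rpow_of_nonneg _ _ (by positivity), ← ENNReal.rpow_mul, mul_assoc,
      ← ENNReal.rpow_add _ _ hx.1 hx.2]
    have : 1 / s + -1 / (s - 1) * ((s - 1) / s) = 0 := by field_simp; ring
    rw [this]; simp
  have h2 := cubeAvg_holder (hf.mul h.meas) (h.meas.pow_const (-1 / (s - 1))) (a := 1 / s)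
    (b := (s - 1) / s) (by positivity) (by positivity) (by field_simp; ring) Q
  have h3 := ENNReal.rpow_le_rpow (h1.trans h2) hsp.le
  refine h3.trans (le_of_eq ?_)
  rw [ENNReal.mul_rpow_of_nonneg _ _ hsp.le, ← ENNReal.rpow_mul, ← ENNReal.rpow_mul]
  have e1 : 1 / s * s = 1 := by field_simp
  have e2 : (s - 1) / s * s = s - 1 := by field_simp
  rw [e1, e2, ENNReal.rpow_one]
  rfl

lemma GoodW.dbl {n : ℕ} {s : ℝ} {T : ℝ≥0∞} {w : (Fin n → ℝ) → ℝ≥0∞} (h : GoodW s T w) :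
    Dbl (volume.withDensity w) ((2 * T) ^ ((7 : ℝ) ^ n)) := by
  have hs := h.hs
  have hs0 : 0 < s - 1 := by linarith
  have hsp : 0 < s := by linarith
  have hball : ∀ (c : Fin n → ℝ) (r : ℝ), volume.withDensity w (Metric.ball c r) =
      ∫⁻ x in Metric.ball c r, w x := fun c r => withDensity_apply _ measurableSet_ball
  have hp : ∀ (c : Fin n → ℝ) (r : ℝ), 0 < r → ∫⁻ x in Metric.ball c r, w x ≠ 0 := by
    intro c r hr h0
    refine h.pos c (r / 2) (by linarith) (le_antisymm ?_ zero_le)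
    rw [← h0]
    exact lintegral_mono_set (Metric.closedBall_subset_ball (by linarith))
  have hf : ∀ (c : Fin n → ℝ) (r : ℝ), 0 < r → ∫⁻ x in Metric.ball c r, w x ≠ ⊤ := by
    intro c r hr h0
    refine h.fin c r hr (top_le_iff.1 ?_)
    rw [← h0]
    exact lintegral_mono_set Metric.ball_subset_closedBall
  intro c r hr
  simp only [hball]
  refine ⟨hp c r hr, hf c r hr, ?_⟩
  set Q := Metric.closedBall c (7 * r) with hQ
  set E := Metric.ball c r with hE
  have h7 : 0 < 7 * r := by linarith
  have hEQ : E ⊆ Q := Metric.ball_subset_closedBall.trans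
    (Metric.closedBall_subset_closedBall (by linarith))
  have hEm : MeasurableSet E := measurableSet_ball
  refine (lintegral_mono_set (Metric.ball_subset_closedBall : _ ⊆ Q)).trans ?_
  have hwQ : ∫⁻ x in Q, w x ≠ ⊤ := h.fin c _ h7
  have hwE0 := hp c r hr
  have hwEt := hf c r hr
  rw [← hE] at hwE0 hwEt
  set R := (∫⁻ x in Q, w x) / ∫⁻ x in E, w x with hR
  have hRt : R ≠ ⊤ := ENNReal.div_ne_top hwQ hwE0
  suffices hmain : R ≤ (2 * T) ^ ((7 : ℝ) ^ n) from
    (ENNReal.div_le_iff_le_mul (Or.inl hwE0) (Or.inl hwEt)).1 hmain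
  classical
  let f : (Fin n → ℝ) → ℝ≥0∞ := E.piecewise (fun _ => R) (fun _ => 1)
  have hfm : Measurable f := Measurable.piecewise hEm measurable_const measurable_const
  have hH := h.holder hfm Q
  have hv0 : volume Q ≠ 0 := vol_pos_s8 c h7
  have hvt : volume Q ≠ ⊤ := vol_fin c _
  -- the upper bound
  have hup : cubeAvg (fun x => f x * w x) Q ≤ 2 * cubeAvg w Q := by
    unfold cubeAvg
    rw [← mul_div_assoc]
    refine ENNReal.div_le_div_right ?_ _
    rw [← lintegral_inter_add_sdiff _ Q hEm]
    have e1 : ∫⁻ x in Q ∩ E, f x * w x = ∫⁻ x in Q, w x := by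
      rw [inter_eq_self_of_subset_right hEQ]
      have : ∫⁻ x in E, f x * w x = ∫⁻ x in E, R * w x :=
        setLIntegral_congr_fun hEm (fun x hx => by simp [f, hx])
      rw [this, lintegral_const_mul _ h.meas, hR, ENNReal.div_mul_cancel hwE0 hwEt]
    have e2 : ∫⁻ x in Q \ E, f x * w x ≤ ∫⁻ x in Q, w x := by
      have : ∫⁻ x in Q \ E, f x * w x = ∫⁻ x in Q \ E, w x :=
        setLIntegral_congr_fun (measurableSet_closedBall.diff hEm)
          (fun x hx => by simp [f, hx.2])
      rw [this]
      exact lintegral_mono_set sdiff_subset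
    rw [e1, two_mul]
    gcongr
  -- the lower bound
  let η : NNReal := ((7 : NNReal) ^ n)⁻¹
  have hη0 : η ≠ 0 := by simp [η]
  have hη1 : η ≤ 1 := by
    refine inv_le_one_of_one_le₀ (one_le_pow₀ (by norm_num))
  have hvE : volume E = η * volume Q := by
    rw [hE, hQ, Real.volume_pi_ball c hr, Real.volume_pi_closedBall c h7.le]
    have : (η : ℝ≥0∞) = ENNReal.ofReal (((7 : ℝ) ^ n)⁻¹) := by
      rw [ENNReal.ofReal, ENNReal.coe_inj]
      refine NNReal.eq ?_
      rw [Real.coe_toNNReal _ (by positivity)]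
      simp [η]
    rw [this, ← ENNReal.ofReal_mul (by positivity)]
    congr 1
    rw [Fintype.card_fin, show 2 * (7 * r) = 7 * (2 * r) by ring, mul_pow 7 (2 * r),
      inv_mul_cancel_left₀ (by positivity)]
  have hvD : volume (Q \ E) = ((1 - η : NNReal) : ℝ≥0∞) * volume Q := by
    have h1 : volume (Q ∩ E) + volume (Q \ E) = volume Q := measure_inter_add_sdiff Q hEm
    rw [inter_eq_self_of_subset_right hEQ, hvE] at h1
    have h2 : (η : ℝ≥0∞) * volume Q + ((1 - η : NNReal) : ℝ≥0∞) * volume Q = volume Q := by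
      rw [← add_mul, ← ENNReal.coe_add, add_tsub_cancel_of_le hη1]; simp
    exact (ENNReal.add_right_inj (ENNReal.mul_ne_top (by simp) hvt)).1 (h1.trans h2.symm)
  have hlow : R ^ ((η : ℝ) / s) ≤ cubeAvg (fun x => f x ^ (1 / s)) Q := by
    have e0 : cubeAvg (fun x => f x ^ (1 / s)) Q = η * R ^ (1 / s) + ((1 - η : NNReal) : ℝ≥0∞) := by
      unfold cubeAvg
      rw [← lintegral_inter_add_sdiff _ Q hEm, inter_eq_self_of_subset_right hEQ]
      have e1 : ∫⁻ x in E, f x ^ (1 / s) = ∫⁻ x in E, R ^ (1 / s) :=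
        setLIntegral_congr_fun hEm (fun x hx => by simp [f, hx])
      have e2 : ∫⁻ x in Q \ E, f x ^ (1 / s) = ∫⁻ x in Q \ E, 1 :=
        setLIntegral_congr_fun (measurableSet_closedBall.diff hEm)
          (fun x hx => by simp [f, hx.2])
      rw [e1, e2, lintegral_const, lintegral_const, Measure.restrict_apply_univ,
        Measure.restrict_apply_univ, hvE, hvD, one_mul]
      rw [show R ^ (1 / s) * (↑η * volume Q) + ↑(1 - η) * volume Q =
        (η * R ^ (1 / s) + ((1 - η : NNReal) : ℝ≥0∞)) * volume Q by ring]
      exact ENNReal.mul_div_cancel_right hv0 hvt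
    rw [e0]
    obtain ⟨R', hR'⟩ : ∃ R' : NNReal, (R' : ℝ≥0∞) = R := ⟨R.toNNReal, ENNReal.coe_toNNReal hRt⟩
    rw [← hR']
    have := NNReal.geom_mean_le_arith_mean2_weighted η (1 - η) (R' ^ (1 / s)) 1
      (add_tsub_cancel_of_le hη1)
    rw [NNReal.one_rpow, mul_one, mul_one, ← NNReal.rpow_mul] at this
    rw [← ENNReal.coe_rpow_of_nonneg _ (by positivity),
      ← ENNReal.coe_rpow_of_nonneg _ (by positivity)]
    rw [show (η : ℝ) / s = 1 / s * η by ring]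
    exact_mod_cast this
  have hfinal : R ^ (η : ℝ) ≤ 2 * T := by
    calc R ^ (η : ℝ) = (R ^ ((η : ℝ) / s)) ^ s := by
          rw [← ENNReal.rpow_mul]; congr 1; field_simp
      _ ≤ _ := ENNReal.rpow_le_rpow hlow hsp.le
      _ ≤ _ := hH
      _ ≤ 2 * cubeAvg w Q * cubeAvg (fun x => w x ^ (-1 / (s - 1))) Q ^ (s - 1) := by gcongr
      _ = 2 * (cubeAvg w Q * cubeAvg (fun x => w x ^ (-1 / (s - 1))) Q ^ (s - 1)) := by ring
      _ ≤ 2 * T := by gcongr; exact h.ap c _ h7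
  calc R = (R ^ (η : ℝ)) ^ ((7 : ℝ) ^ n) := by
        rw [← ENNReal.rpow_mul]
        have : (η : ℝ) * (7 : ℝ) ^ n = 1 := by simp [η]
        rw [this, ENNReal.rpow_one]
    _ ≤ _ := ENNReal.rpow_le_rpow hfinal (by positivity)

end

noncomputable section

lemma mul_rpow_right {x y : ℝ≥0∞} (hy : y ≠ 0) (hy' : y ≠ ⊤) (z : ℝ) :
    (x * y) ^ z = x ^ z * y ^ z := by simp [ENNReal.mul_rpow_eq_ite, hy, hy']

lemma rpow_anti_nonpos {x y : ℝ≥0∞} {z : ℝ} (hz : z ≤ 0) (h : x ≤ y) : y ^ z ≤ x ^ z := by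
  rw [← neg_neg z, ENNReal.rpow_neg y (-z), ENNReal.rpow_neg x (-z)]
  exact ENNReal.inv_le_inv.2 (ENNReal.rpow_le_rpow h (show 0 ≤ -z by linarith))

/-- Average bookkeeping. -/
lemma GoodW.avg_mul {n : ℕ} {s : ℝ} {T : ℝ≥0∞} {w : (Fin n → ℝ) → ℝ≥0∞} (h : GoodW s T w)
    {v : (Fin n → ℝ) → ℝ≥0∞} (hv : Measurable v) (c : Fin n → ℝ) {r : ℝ} (hr : 0 < r) :
    cubeAvg (fun x => w x * v x) (Metric.closedBall c r) =
      ((∫⁻ x in Metric.closedBall c r, v x ∂(volume.withDensity w)) /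
        volume.withDensity w (Metric.closedBall c r)) * cubeAvg w (Metric.closedBall c r) := by
  rw [setLIntegral_withDensity_eq_setLIntegral_mul _ h.meas hv measurableSet_closedBall,
    withDensity_apply _ measurableSet_closedBall, cubeAvg, cubeAvg, ← mul_div_assoc,
    ENNReal.div_mul_cancel (h.pos c r hr) (h.fin c r hr)]
  rfl

lemma GoodW.mul_a1 {n : ℕ} {s : ℝ} {T : ℝ≥0∞} {w : (Fin n → ℝ) → ℝ≥0∞} (h : GoodW s T w)
    {v : (Fin n → ℝ) → ℝ≥0∞} (hv : Measurable v) (hv0 : ∀ x, v x ≠ 0) (hvt : ∀ x, v x ≠ ⊤)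
    {C : ℝ≥0∞} (hC0 : C ≠ 0) (hCt : C ≠ ⊤)
    (hA : ∀ (c : Fin n → ℝ) (r : ℝ), 0 < r → ∀ z ∈ Metric.closedBall c r,
      ∫⁻ x in Metric.closedBall c r, v x ∂(volume.withDensity w) ≤
        C * v z * volume.withDensity w (Metric.closedBall c r)) :
    apConst s (fun x => w x * v x) ≤ C * T := by
  have hs := h.hs
  have hs0 : 0 < s - 1 := by linarith
  rw [apConst, if_neg hs.ne']
  refine iSup₂_le fun Q hQ => ?_
  obtain ⟨c, r, hr, rfl⟩ := hQ.eq_closedBall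
  set Q := Metric.closedBall c r with hQd
  have hν : volume.withDensity w Q = ∫⁻ x in Q, w x := withDensity_apply _ measurableSet_closedBall
  have hν0 : volume.withDensity w Q ≠ 0 := by rw [hν]; exact h.pos c r hr
  have hνt : volume.withDensity w Q ≠ ⊤ := by rw [hν]; exact h.fin c r hr
  rw [h.avg_mul hv c hr]
  set a := (∫⁻ x in Q, v x ∂(volume.withDensity w)) / volume.withDensity w Q with ha
  have haz : ∀ z ∈ Q, a ≤ C * v z := fun z hz =>
    (ENNReal.div_le_iff_le_mul (Or.inl hν0) (Or.inl hνt)).2 (hA c r hr z hz)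
  have hat : a ≠ ⊤ := ne_top_of_le_ne_top (ENNReal.mul_ne_top hCt (hvt c))
    (haz c (Metric.mem_closedBall_self hr.le))
  have ha0 : a ≠ 0 := by
    rw [ha, Ne, ENNReal.div_eq_zero_iff]; push Not
    refine ⟨fun h0 => hν0 ?_, hνt⟩
    have := (lintegral_eq_zero_iff hv).1 h0
    rw [← Measure.restrict_apply_univ]
    refine measure_mono_null ?_ this
    intro x _; exact hv0 x
  have hb0 : a / C ≠ 0 := by
    rw [Ne, ENNReal.div_eq_zero_iff]; push Not; exact ⟨ha0, hCt⟩
  have hbt : a / C ≠ ⊤ := ENNReal.div_ne_top hat hC0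
  have h1 : cubeAvg (fun x => (w x * v x) ^ (-1 / (s - 1))) Q ≤
      (a / C) ^ (-1 / (s - 1)) * cubeAvg (fun x => w x ^ (-1 / (s - 1))) Q := by
    unfold cubeAvg
    rw [← mul_div_assoc, ← lintegral_const_mul _ (h.meas.pow_const _)]
    refine ENNReal.div_le_div_right (setLIntegral_mono' measurableSet_closedBall fun x hx => ?_) _
    rw [mul_rpow_right (hv0 x) (hvt x), mul_comm]
    refine mul_le_mul_left ?_ _
    refine rpow_anti_nonpos (div_nonpos_of_nonpos_of_nonneg (by norm_num) hs0.le) ?_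
    rw [ENNReal.div_le_iff_le_mul (Or.inl hC0) (Or.inl hCt), mul_comm]
    exact haz x hx
  have h2 := ENNReal.rpow_le_rpow h1 hs0.le
  rw [ENNReal.mul_rpow_of_nonneg _ _ hs0.le, ← ENNReal.rpow_mul] at h2
  have e1 : -1 / (s - 1) * (s - 1) = -1 := by field_simp
  rw [e1, ENNReal.rpow_neg_one] at h2
  calc _ ≤ a * cubeAvg w Q * ((a / C)⁻¹ * cubeAvg (fun x => w x ^ (-1 / (s - 1))) Q ^ (s - 1)) := by
        gcongr
    _ = (a * (a / C)⁻¹) * (cubeAvg w Q * cubeAvg (fun x => w x ^ (-1 / (s - 1))) Q ^ (s - 1)) := by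
        ring
    _ ≤ C * T := by
        refine mul_le_mul' (le_of_eq ?_) (h.ap c r hr)
        rw [ENNReal.inv_div (Or.inl hCt) (Or.inl hC0), ENNReal.mul_div_cancel ha0 hat]

lemma GoodW.mul_a1_neg {n : ℕ} {s : ℝ} {T : ℝ≥0∞} {w : (Fin n → ℝ) → ℝ≥0∞} (h : GoodW s T w)
    {u : (Fin n → ℝ) → ℝ≥0∞} (hu : Measurable u) (hu0 : ∀ x, u x ≠ 0) (hut : ∀ᵐ x, u x ≠ ⊤)
    {C : ℝ≥0∞} (hC0 : C ≠ 0) (hCt : C ≠ ⊤) {k : ℝ} (hk : 0 ≤ k)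
    (hA : ∀ (c : Fin n → ℝ) (r : ℝ), 0 < r → ∀ z ∈ Metric.closedBall c r,
      ∫⁻ x in Metric.closedBall c r, u x ∂(volume.withDensity w) ≤
        C * u z * volume.withDensity w (Metric.closedBall c r)) :
    apConst ((1 + k) * s) (fun x => w x * u x ^ (-k)) ≤ C ^ k * T ^ (1 + k) := by
  have hs := h.hs
  have hs0 : 0 < s - 1 := by linarith
  set m := (1 + k) * s with hm
  have hm1 : 1 < m := by nlinarith
  have hm0 : 0 < m - 1 := by linarith
  rw [apConst, if_neg hm1.ne']
  refine iSup₂_le fun Q hQ => ?_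
  obtain ⟨c, r, hr, rfl⟩ := hQ.eq_closedBall
  set Q := Metric.closedBall c r with hQd
  have hν : volume.withDensity w Q = ∫⁻ x in Q, w x := withDensity_apply _ measurableSet_closedBall
  have hν0 : volume.withDensity w Q ≠ 0 := by rw [hν]; exact h.pos c r hr
  have hνt : volume.withDensity w Q ≠ ⊤ := by rw [hν]; exact h.fin c r hr
  have havg := h.avg_mul hu c hr
  set a := (∫⁻ x in Q, u x ∂(volume.withDensity w)) / volume.withDensity w Q with ha
  have haz : ∀ z ∈ Q, a ≤ C * u z := fun z hz =>
    (ENNReal.div_le_iff_le_mul (Or.inl hν0) (Or.inl hνt)).2 (hA c r hr z hz)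
  have hat : a ≠ ⊤ := by
    have : ∃ z ∈ Q, u z ≠ ⊤ := by
      by_contra hno
      push Not at hno
      refine vol_pos_s8 c hr (measure_mono_null ?_ (ae_iff.1 hut))
      intro z hz
      exact not_not.2 (hno z hz)
    obtain ⟨z, hz, hzt⟩ := this
    exact ne_top_of_le_ne_top (ENNReal.mul_ne_top hCt hzt) (haz z hz)
  have ha0 : a ≠ 0 := by
    rw [ha, Ne, ENNReal.div_eq_zero_iff]; push Not
    refine ⟨fun h0 => hν0 ?_, hνt⟩
    have := (lintegral_eq_zero_iff hu).1 h0
    rw [← Measure.restrict_apply_univ]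
    refine measure_mono_null ?_ this
    intro x _; exact hu0 x
  set X := cubeAvg w Q with hX
  set W := cubeAvg (fun x => w x ^ (-1 / (s - 1))) Q with hW
  have hb0 : a / C ≠ 0 := by
    rw [Ne, ENNReal.div_eq_zero_iff]; push Not; exact ⟨ha0, hCt⟩
  have hbt : a / C ≠ ⊤ := ENNReal.div_ne_top hat hC0
  have h1 : cubeAvg (fun x => w x * u x ^ (-k)) Q ≤ X * (a / C) ^ (-k) := by
    rw [hX, mul_comm]
    unfold cubeAvg
    rw [← mul_div_assoc, ← lintegral_const_mul _ h.meas]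
    refine ENNReal.div_le_div_right (setLIntegral_mono' measurableSet_closedBall fun x hx => ?_) _
    rw [mul_comm]
    refine mul_le_mul_left ?_ _
    refine rpow_anti_nonpos (by linarith) ?_
    rw [ENNReal.div_le_iff_le_mul (Or.inl hC0) (Or.inl hCt), mul_comm]
    exact haz x hx
  have hθ : 1 - k / (m - 1) = (1 + k) * (s - 1) / (m - 1) := by
    field_simp; rw [hm]; ring
  have hθ0 : 0 ≤ 1 - k / (m - 1) := by rw [hθ]; positivity
  have h2 : cubeAvg (fun x => (w x * u x ^ (-k)) ^ (-1 / (m - 1))) Q ≤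
      cubeAvg (fun x => (w x * u x) ^ (k / (m - 1)) *
        (w x ^ (-1 / (s - 1))) ^ (1 - k / (m - 1))) Q := by
    refine cubeAvg_mono_ae (ae_restrict_of_ae ?_)
    filter_upwards [h.ae, hut] with x hx hxu
    have hux : u x ^ (-k) ≠ 0 := by simp [ENNReal.rpow_eq_zero_iff, hu0 x, hxu]
    have hux' : u x ^ (-k) ≠ ⊤ := by simp [ENNReal.rpow_eq_top_iff, hu0 x, hxu]
    rw [mul_rpow_right hux hux', mul_rpow_right (hu0 x) hxu, ← ENNReal.rpow_mul,
      ← ENNReal.rpow_mul, mul_right_comm, ← ENNReal.rpow_add _ _ hx.1 hx.2]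
    have e1 : k / (m - 1) + -1 / (s - 1) * (1 - k / (m - 1)) = -1 / (m - 1) := by
      rw [hθ]; field_simp; ring
    have e2 : -k * (-1 / (m - 1)) = k / (m - 1) := by ring
    rw [e1, e2]
  have h3 := h2.trans (cubeAvg_holder (h.meas.mul hu) (h.meas.pow_const (-1 / (s - 1)))
    (a := k / (m - 1)) (b := 1 - k / (m - 1)) (by positivity) hθ0 (by ring) Q)
  have h4 := ENNReal.rpow_le_rpow h3 hm0.le
  have e3 : cubeAvg (w * u) Q = a * X := havg
  rw [ENNReal.mul_rpow_of_nonneg _ _ hm0.le, ← ENNReal.rpow_mul, ← ENNReal.rpow_mul, e3, ← hW,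
    hθ] at h4
  have e4 : k / (m - 1) * (m - 1) = k := by field_simp
  have e5 : (1 + k) * (s - 1) / (m - 1) * (m - 1) = (s - 1) * (1 + k) := by field_simp
  rw [e4, e5, ENNReal.rpow_mul, ENNReal.mul_rpow_of_nonneg _ _ hk] at h4
  obtain ⟨hX0, hXt⟩ := h.avg_ne c hr
  calc _ ≤ X * (a / C) ^ (-k) * (a ^ k * X ^ k * (W ^ (s - 1)) ^ (1 + k)) := by gcongr
    _ = ((a / C) ^ (-k) * a ^ k) * (X ^ (1 : ℝ) * X ^ k * (W ^ (s - 1)) ^ (1 + k)) := by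
        rw [ENNReal.rpow_one]; ring
    _ = C ^ k * (X * W ^ (s - 1)) ^ (1 + k) := by
        rw [← ENNReal.rpow_add _ _ hX0 hXt, ENNReal.mul_rpow_of_nonneg _ _ (by linarith)]
        congr 1
        rw [ENNReal.rpow_neg, ← ENNReal.inv_rpow, ← ENNReal.mul_rpow_of_nonneg _ _ hk,
          ENNReal.inv_div (Or.inl hCt) (Or.inl hC0), ENNReal.div_mul_cancel ha0 hat]
    _ ≤ _ := by
        gcongr
        exact h.ap c r hr

end

noncomputable section

/-- The hypothesis tested on one weight. -/
lemma test_ineq {n : ℕ} {p₀ : ℝ} (hp₀ : 1 ≤ p₀) {f g : (Fin n → ℝ) → ℝ≥0∞}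
    {φ : ℝ≥0∞ → ℝ≥0∞}
    (H : ∀ w : (Fin n → ℝ) → ℝ≥0∞, Measurable w → ainfConst w < ⊤ →
      wkNorm p₀ w g ≤ φ (ainfConst w) * stNorm p₀ w f)
    {T' Cφ : ℝ≥0∞} (hT' : T' ≠ ⊤) (hCφ : ∀ t ≤ T', φ t ≤ Cφ)
    {V : (Fin n → ℝ) → ℝ≥0∞} (hV : Measurable V) {m : ℝ} (hm : 1 < m) (hap : apConst m V ≤ T')
    (y : ℝ≥0∞) :
    y ^ p₀ * ∫⁻ x in {x | y < g x}, V x ≤ Cφ ^ p₀ * ∫⁻ x, f x ^ p₀ * V x := by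
  have hp : 0 < p₀ := by linarith
  have ha : ainfConst V ≤ T' := (iInf₂_le m hm).trans hap
  have h1 := H V hV (ha.trans_lt (lt_top_iff_ne_top.2 hT'))
  have h2 : y * (wMeas V {x | y < g x}) ^ (1 / p₀) ≤ Cφ * stNorm p₀ V f :=
    (le_iSup (fun y : ℝ≥0∞ => y * (wMeas V {x | y < g x}) ^ (1 / p₀)) y).trans
      (h1.trans (mul_le_mul_left (hCφ _ ha) _))
  have h3 := ENNReal.rpow_le_rpow h2 hp.le
  rw [ENNReal.mul_rpow_of_nonneg _ _ hp.le, ENNReal.mul_rpow_of_nonneg _ _ hp.le, stNorm,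
    ← ENNReal.rpow_mul, ← ENNReal.rpow_mul, one_div_mul_cancel hp.ne', ENNReal.rpow_one,
    ENNReal.rpow_one] at h3
  exact h3

lemma caseA_pt {f N : ℝ≥0∞} {p p₀ : ℝ} (hp : 0 < p) (hpp : p ≤ p₀) (hN : f ^ p ≤ N) :
    f ^ p₀ * N ^ (-((p₀ - p) / p)) ≤ f ^ p := by
  have hq : 0 ≤ (p₀ - p) / p := div_nonneg (by linarith) hp.le
  have hp0 : 0 < p₀ := by linarith
  rcases eq_or_ne f 0 with rfl | h0
  · simp [hp0]
  rcases eq_or_ne f ⊤ with rfl | ht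
  · simp [hp]
  calc f ^ p₀ * N ^ (-((p₀ - p) / p)) ≤ f ^ p₀ * (f ^ p) ^ (-((p₀ - p) / p)) :=
        mul_le_mul_right (rpow_anti_nonpos (by linarith) hN) _
    _ = f ^ p := by
        rw [← ENNReal.rpow_mul, ← ENNReal.rpow_add _ _ h0 ht]
        congr 1
        field_simp; ring

lemma caseA {n : ℕ} {p₀ : ℝ} (hp₀ : 1 ≤ p₀) {f g : (Fin n → ℝ) → ℝ≥0∞} (hf : Measurable f)
    (hg : Measurable g) {φ : ℝ≥0∞ → ℝ≥0∞} (hφ : LocBdd φ)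
    (H : ∀ w : (Fin n → ℝ) → ℝ≥0∞, Measurable w → ainfConst w < ⊤ →
      wkNorm p₀ w g ≤ φ (ainfConst w) * stNorm p₀ w f)
    {p : ℝ} (hp : 0 < p) (hpp : p ≤ p₀) {T : ℝ≥0∞} (hT : T ≠ ⊤) :
    ∃ K : ℝ≥0∞, K ≠ ⊤ ∧ ∀ (s : ℝ) (w : (Fin n → ℝ) → ℝ≥0∞), GoodW s T w →
      ∫⁻ x, f x ^ p ∂(volume.withDensity w) ≠ 0 → ∫⁻ x, f x ^ p ∂(volume.withDensity w) ≠ ⊤ →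
      ∀ y : ℝ≥0∞, y ≠ 0 → y ≠ ⊤ →
        y ^ p * volume.withDensity w {x | y < g x} ≤ K * ∫⁻ x, f x ^ p ∂(volume.withDensity w) := by
  have hp0 : 0 < p₀ := by linarith
  set D : ℝ≥0∞ := (2 * T) ^ ((7 : ℝ) ^ n) with hD
  have hDt : D ≠ ⊤ := ENNReal.rpow_ne_top_of_nonneg (by positivity)
    (ENNReal.mul_ne_top (by simp) hT)
  set C := CA (1 / 2) D with hC
  have hCt : C ≠ ⊤ := CA_ne_top (by norm_num) (by norm_num) hDt
  have hC0 : C ≠ 0 := CA_ne_zero _ _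
  set k : ℝ := 2 * ((p₀ - p) / p) with hk
  have hk0 : 0 ≤ k := mul_nonneg (by norm_num) (div_nonneg (by linarith) hp.le)
  have hT' : C ^ k * T ^ (1 + k) ≠ ⊤ := ENNReal.mul_ne_top
    (ENNReal.rpow_ne_top_of_nonneg hk0 hCt) (ENNReal.rpow_ne_top_of_nonneg (by linarith) hT)
  obtain ⟨Cφ, hCφt, hCφ⟩ := hφ _ hT'
  refine ⟨D + 1 + Cφ ^ p₀, ?_, ?_⟩
  · exact ENNReal.add_ne_top.2 ⟨ENNReal.add_ne_top.2 ⟨hDt, by simp⟩,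
      ENNReal.rpow_ne_top_of_nonneg hp0.le hCφt⟩
  intro s w hw h0 ht y hy0 hyt
  set ν := volume.withDensity w with hν
  have hdbl : Dbl ν D := hw.dbl
  have hfp : Measurable fun x => f x ^ p := hf.pow_const _
  set N := nf ν (fun x => f x ^ p) with hN
  have hNm : Measurable N := measurable_nf _ _ hfp
  have hN0 : ∀ x, N x ≠ 0 := fun x =>
    (lt_of_lt_of_le (pos_iff_ne_zero.2 (mf_pos hdbl _ h0 x)) (le_max_right _ _)).ne'
  have hweak := weak_nf hdbl _ hfp
  have hNtν : ν {x | N x = ⊤} = 0 := by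
    by_contra hne
    set I := (D + 1) * ∫⁻ x, f x ^ p ∂ν with hI
    have hIt : I ≠ ⊤ := ENNReal.mul_ne_top (ENNReal.add_ne_top.2 ⟨hDt, by simp⟩) ht
    have hb : ∀ l : ℝ≥0∞, l ≠ ⊤ → l * ν {x | N x = ⊤} ≤ I := by
      intro l hl
      refine (mul_le_mul_right (measure_mono ?_) l).trans (hweak l)
      intro x hx
      have hx' : N x = ⊤ := hx
      change l < N x
      rw [hx']; exact lt_top_iff_ne_top.2 hl
    obtain ⟨j, hj⟩ := ENNReal.exists_nat_mul_gt hne hIt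
    exact absurd (hb j (by simp)) (not_le.2 hj)
  have hNt : ∀ᵐ x, N x ≠ ⊤ := by
    have hms : MeasurableSet {x | N x = ⊤} := hNm (measurableSet_singleton _)
    have h1 : ∀ᵐ x ∂ν, N x ≠ ⊤ := by
      rw [ae_iff]; simpa using hNtν
    rw [hν, ae_withDensity_iff hw.meas] at h1
    filter_upwards [h1, hw.ae] with x hx hx2 using hx hx2.1
  have hum : Measurable fun x => N x ^ (1 / 2 : ℝ) := hNm.pow_const _
  have hap := hw.mul_a1_neg (u := fun x => N x ^ (1 / 2 : ℝ)) hum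
    (fun x => by simp [ENNReal.rpow_eq_zero_iff, hN0 x])
    (by filter_upwards [hNt] with x hx; simp [hx]) hC0 hCt hk0
    (fun c r hr z hz => a1_nf hdbl hfp h0 (by norm_num) c hr hz)
  have hVm : Measurable fun x => w x * (N x ^ (1 / 2 : ℝ)) ^ (-k) := hw.meas.mul (hum.pow_const _)
  have hm1 : 1 < (1 + k) * s := by nlinarith [hw.hs]
  have htest := test_ineq hp₀ H hT' hCφ hVm hm1 hap y
  have hexp : ∀ x, (N x ^ (1 / 2 : ℝ)) ^ (-k) = N x ^ (-((p₀ - p) / p)) := fun x => by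
    rw [← ENNReal.rpow_mul]; congr 1; rw [hk]; ring
  simp_rw [hexp] at htest hVm
  have hE : MeasurableSet {x | y < g x} := measurableSet_lt measurable_const hg
  have hGm : Measurable fun x => N x ^ (-((p₀ - p) / p)) := hNm.pow_const _
  -- right side
  have hR : ∫⁻ x, f x ^ p₀ * (w x * N x ^ (-((p₀ - p) / p))) ≤ ∫⁻ x, f x ^ p ∂ν := by
    rw [hν, lintegral_withDensity_eq_lintegral_mul _ hw.meas hfp]
    refine lintegral_mono fun x => ?_
    calc f x ^ p₀ * (w x * N x ^ (-((p₀ - p) / p)))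
        = w x * (f x ^ p₀ * N x ^ (-((p₀ - p) / p))) := by ring
      _ ≤ w x * f x ^ p := mul_le_mul_right (caseA_pt hp hpp (le_max_left _ _)) _
  -- left side
  set A := {x | y < g x} ∩ {x | N x ≤ y ^ p} with hA
  have hAm : MeasurableSet A := hE.inter (measurableSet_le hNm measurable_const)
  have hL : y ^ p * ν A ≤ y ^ p₀ * ∫⁻ x in {x | y < g x}, w x * N x ^ (-((p₀ - p) / p)) := by
    have : ν A ≤ y ^ (p₀ - p) * ∫⁻ x in A, w x * N x ^ (-((p₀ - p) / p)) := by
      rw [← lintegral_const_mul _ hVm, hν, withDensity_apply _ hAm]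
      refine setLIntegral_mono' hAm fun x hx => ?_
      have h1 : (y ^ p) ^ (-((p₀ - p) / p)) ≤ N x ^ (-((p₀ - p) / p)) :=
        rpow_anti_nonpos (by linarith) hx.2
      rw [← ENNReal.rpow_mul, show p * (-((p₀ - p) / p)) = -(p₀ - p) by field_simp] at h1
      calc w x = y ^ (p₀ - p) * (w x * y ^ (-(p₀ - p))) := by
            rw [mul_left_comm, ← ENNReal.rpow_add _ _ hy0 hyt]; simp
        _ ≤ _ := by gcongr
    calc y ^ p * ν A ≤ y ^ p * (y ^ (p₀ - p) * ∫⁻ x in A, w x * N x ^ (-((p₀ - p) / p))) :=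
          mul_le_mul_right this _
      _ = y ^ p₀ * ∫⁻ x in A, w x * N x ^ (-((p₀ - p) / p)) := by
          rw [← mul_assoc, ← ENNReal.rpow_add _ _ hy0 hyt]; congr 2; ring
      _ ≤ _ := mul_le_mul_right (lintegral_mono_set inter_subset_left) _
  have hsub : {x | y < g x} ⊆ {x | y ^ p < N x} ∪ A := by
    intro x hx
    rcases lt_or_ge (y ^ p) (N x) with h | h
    · exact Or.inl h
    · exact Or.inr ⟨hx, h⟩
  calc y ^ p * ν {x | y < g x} ≤ y ^ p * (ν {x | y ^ p < N x} + ν A) :=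
        mul_le_mul_right ((measure_mono hsub).trans (measure_union_le _ _)) _
    _ = y ^ p * ν {x | y ^ p < N x} + y ^ p * ν A := mul_add _ _ _
    _ ≤ (D + 1) * ∫⁻ x, f x ^ p ∂ν + Cφ ^ p₀ * ∫⁻ x, f x ^ p ∂ν :=
        add_le_add (hweak _) (hL.trans (htest.trans (mul_le_mul_right hR _)))
    _ = _ := by ring

lemma caseB {n : ℕ} {p₀ : ℝ} (hp₀ : 1 ≤ p₀) {f g : (Fin n → ℝ) → ℝ≥0∞} (hf : Measurable f)
    (hg : Measurable g) {φ : ℝ≥0∞ → ℝ≥0∞} (hφ : LocBdd φ)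
    (H : ∀ w : (Fin n → ℝ) → ℝ≥0∞, Measurable w → ainfConst w < ⊤ →
      wkNorm p₀ w g ≤ φ (ainfConst w) * stNorm p₀ w f)
    {p : ℝ} (hpp : p₀ < p) {T : ℝ≥0∞} (hT : T ≠ ⊤) :
    ∃ K : ℝ≥0∞, K ≠ ⊤ ∧ ∀ (s : ℝ) (w : (Fin n → ℝ) → ℝ≥0∞), GoodW s T w →
      ∀ y : ℝ≥0∞,
        y ^ p * volume.withDensity w {x | y < g x} ≤ K * ∫⁻ x, f x ^ p ∂(volume.withDensity w) := by
  have hp0 : 0 < p₀ := by linarith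
  have hp : 0 < p := by linarith
  set D : ℝ≥0∞ := (2 * T) ^ ((7 : ℝ) ^ n) with hD
  have hDt : D ≠ ⊤ := ENNReal.rpow_ne_top_of_nonneg (by positivity)
    (ENNReal.mul_ne_top (by simp) hT)
  set b : ℝ := 1 - p₀ / p with hb
  have hb1 : b < 1 := by have : 0 < p₀ / p := by positivity
                         linarith
  have hb0 : 0 < b := by have : p₀ / p < 1 := (div_lt_one hp).2 hpp
                         linarith
  set d : ℝ := (1 + b) / 2 with hd
  have hd0 : 0 < d := by linarith
  have hd1 : d < 1 := by linarith
  have hbd : b < d := by linarith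
  set a : ℝ := d / b with ha
  have ha1 : 1 < a := (one_lt_div hb0).2 hbd
  set C := CA d D with hC
  have hCt : C ≠ ⊤ := CA_ne_top hd0 hd1 hDt
  have hC0 : C ≠ 0 := CA_ne_zero _ _
  have hT' : C * T ≠ ⊤ := ENNReal.mul_ne_top hCt hT
  obtain ⟨Cφ, hCφt, hCφ⟩ := hφ _ hT'
  set B := CS a * (D + 1) with hB
  have hBt : B ≠ ⊤ := ENNReal.mul_ne_top (CS_ne_top ha1) (ENNReal.add_ne_top.2 ⟨hDt, by simp⟩)
  refine ⟨(Cφ ^ p₀ * B ^ b) ^ (p / p₀), ?_, ?_⟩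
  · exact ENNReal.rpow_ne_top_of_nonneg (by positivity) (ENNReal.mul_ne_top
      (ENNReal.rpow_ne_top_of_nonneg hp0.le hCφt) (ENNReal.rpow_ne_top_of_nonneg hb0.le hBt))
  intro s w hw y
  set ν := volume.withDensity w with hν
  have hdbl : Dbl ν D := hw.dbl
  have hE : MeasurableSet {x | y < g x} := measurableSet_lt measurable_const hg
  have hfp : Measurable fun x => f x ^ p := hf.pow_const _
  set I := ∫⁻ x, f x ^ p ∂ν with hI
  have key : ∀ R : ℕ, y ^ p * ν ({x | y < g x} ∩ Metric.ball 0 (R + 1)) ≤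
      (Cφ ^ p₀ * B ^ b) ^ (p / p₀) * I := by
    intro R
    set E := {x | y < g x} ∩ Metric.ball 0 ((R : ℝ) + 1) with hEd
    have hEm : MeasurableSet E := hE.inter measurableSet_ball
    have hEt : ν E ≠ ⊤ := ne_top_of_le_ne_top (hdbl 0 ((R : ℝ) + 1) (by positivity)).2.1
      (measure_mono inter_subset_right)
    rcases eq_or_ne (ν E) 0 with hE0 | hE0
    · rw [hE0, mul_zero]; exact zero_le
    set χ : (Fin n → ℝ) → ℝ≥0∞ := E.indicator 1 with hχ
    have hχm : Measurable χ := measurable_one.indicator hEm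
    have hχi : ∫⁻ x, χ x ∂ν = ν E := lintegral_indicator_one hEm
    have hχ0 : ∫⁻ x, χ x ∂ν ≠ 0 := by rwa [hχi]
    have hχ1 : ∀ x, χ x ≤ 1 := fun x => indicator_le_self' (fun _ _ => zero_le) x
    set N := nf ν χ with hN
    have hNm : Measurable N := measurable_nf _ _ hχm
    have hN0 : ∀ x, N x ≠ 0 := fun x =>
      (lt_of_lt_of_le (pos_iff_ne_zero.2 (mf_pos hdbl _ hχ0 x)) (le_max_right _ _)).ne'
    have hN1 : ∀ x, N x ≤ 1 := by
      intro x
      refine max_le (hχ1 x) ?_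
      refine iSup_le fun c => iSup_le fun r => iSup_le fun hr => ?_
      refine ENNReal.div_le_of_le_mul ?_
      rw [one_mul]
      calc ∫⁻ z in Metric.ball c r, χ z ∂ν ≤ ∫⁻ z in Metric.ball c r, 1 ∂ν := lintegral_mono hχ1
        _ = _ := by simp
    have hNt : ∀ x, N x ≠ ⊤ := fun x => ne_top_of_le_ne_top (by simp) (hN1 x)
    have hvm : Measurable fun x => N x ^ d := hNm.pow_const _
    have hap := hw.mul_a1 (v := fun x => N x ^ d) hvm
      (fun x => by simp [ENNReal.rpow_eq_zero_iff, hN0 x, hNt x])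
      (fun x => ENNReal.rpow_ne_top_of_nonneg hd0.le (hNt x)) hC0 hCt
      (fun c r hr z hz => a1_nf hdbl hχm hχ0 hd0 c hr hz)
    have hVm : Measurable fun x => w x * N x ^ d := hw.meas.mul hvm
    have htest := test_ineq hp₀ H hT' hCφ hVm hw.hs hap y
    have hL : ν E ≤ ∫⁻ x in {x | y < g x}, w x * N x ^ d := by
      rw [hν, withDensity_apply _ hEm]
      refine le_trans (setLIntegral_mono' hEm fun x hx => ?_)
        (lintegral_mono_set inter_subset_left)
      have h1 : 1 ≤ N x := by
        refine le_trans ?_ (le_max_left _ _)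
        simp [hχ, hx]
      calc w x = w x * 1 := (mul_one _).symm
        _ ≤ w x * N x ^ d := mul_le_mul_right (ENNReal.one_le_rpow h1 hd0) _
    have hR : ∫⁻ x, f x ^ p₀ * (w x * N x ^ d) ≤ I ^ (p₀ / p) * (B * ν E) ^ b := by
      calc ∫⁻ x, f x ^ p₀ * (w x * N x ^ d) = ∫⁻ x, (f x ^ p) ^ (p₀ / p) * (N x ^ a) ^ b ∂ν := by
            have hmm : Measurable fun x => (f x ^ p) ^ (p₀ / p) * (N x ^ a) ^ b :=
              (hfp.pow_const _).mul ((hNm.pow_const _).pow_const _)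
            rw [hν, lintegral_withDensity_eq_lintegral_mul _ hw.meas hmm]
            refine lintegral_congr fun x => ?_
            simp only [Pi.mul_apply]
            rw [← ENNReal.rpow_mul, ← ENNReal.rpow_mul, mul_div_cancel₀ _ hp.ne',
              show a * b = d by rw [ha]; field_simp]
            ring
        _ ≤ I ^ (p₀ / p) * (∫⁻ x, N x ^ a ∂ν) ^ b :=
            ENNReal.lintegral_mul_norm_pow_le hfp.aemeasurable (hNm.pow_const _).aemeasurable
              (by positivity) hb0.le (by rw [hb]; ring)
        _ ≤ _ := by
            gcongr
            have := strong_le_one (ν := ν) (B := (D + 1) * ν E) hNm hN1 (by linarith : 0 < a)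
              (fun l => by rw [← hχi]; exact weak_nf hdbl χ hχm l)
            rwa [← mul_assoc] at this
    have h1 : y ^ p₀ * ν E ≤ Cφ ^ p₀ * (I ^ (p₀ / p) * (B * ν E) ^ b) :=
      (mul_le_mul_right hL _).trans (htest.trans (mul_le_mul_right hR _))
    rw [ENNReal.mul_rpow_of_nonneg _ _ hb0.le] at h1
    have hEb0 : ν E ^ b ≠ 0 := by simp [ENNReal.rpow_eq_zero_iff, hE0, hEt]
    have hEbt : ν E ^ b ≠ ⊤ := ENNReal.rpow_ne_top_of_nonneg hb0.le hEt
    have h2 : y ^ p₀ * ν E ^ (p₀ / p) ≤ Cφ ^ p₀ * B ^ b * I ^ (p₀ / p) := by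
      rw [← ENNReal.mul_le_mul_iff_left hEb0 hEbt]
      calc y ^ p₀ * ν E ^ (p₀ / p) * ν E ^ b = y ^ p₀ * ν E := by
            rw [mul_assoc, ← ENNReal.rpow_add _ _ hE0 hEt, hb]
            simp
        _ ≤ _ := h1
        _ = _ := by ring
    have hpp' : 0 ≤ p / p₀ := by positivity
    have h3 := ENNReal.rpow_le_rpow h2 hpp'
    rw [ENNReal.mul_rpow_of_nonneg _ _ hpp', ENNReal.mul_rpow_of_nonneg _ (I ^ _) hpp',
      ← ENNReal.rpow_mul, ← ENNReal.rpow_mul, ← ENNReal.rpow_mul I,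
      show p₀ * (p / p₀) = p by field_simp, show p₀ / p * (p / p₀) = 1 by field_simp,
      ENNReal.rpow_one, ENNReal.rpow_one] at h3
    exact h3
  have hmono : Monotone fun R : ℕ => {x | y < g x} ∩ Metric.ball (0 : Fin n → ℝ) ((R : ℝ) + 1) := by
    intro i j hij
    refine inter_subset_inter_right _ (Metric.ball_subset_ball ?_)
    have : (i : ℝ) ≤ j := by exact_mod_cast hij
    linarith
  have hU : {x | y < g x} = ⋃ R : ℕ, {x | y < g x} ∩ Metric.ball (0 : Fin n → ℝ) ((R : ℝ) + 1) := by
    rw [← inter_iUnion]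
    refine (inter_eq_left.2 ?_).symm
    intro x _
    obtain ⟨R, hR⟩ := exists_nat_gt (dist x 0)
    exact mem_iUnion.2 ⟨R, Metric.mem_ball.2 (by linarith)⟩
  have hlim := hmono.measure_iUnion (μ := ν)
  rw [← hU] at hlim
  rw [hlim, ENNReal.mul_iSup]
  exact iSup_le key

lemma main_const {n : ℕ} {p₀ : ℝ} (hp₀ : 1 ≤ p₀) {f g : (Fin n → ℝ) → ℝ≥0∞} (hf : Measurable f)
    (hg : Measurable g) {φ : ℝ≥0∞ → ℝ≥0∞} (hφ : LocBdd φ)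
    (H : ∀ w : (Fin n → ℝ) → ℝ≥0∞, Measurable w → ainfConst w < ⊤ →
      wkNorm p₀ w g ≤ φ (ainfConst w) * stNorm p₀ w f)
    {p : ℝ} (hp : 0 < p) {t : ℝ≥0∞} (ht : t ≠ ⊤) :
    ∃ K : ℝ≥0∞, K ≠ ⊤ ∧ ∀ w : (Fin n → ℝ) → ℝ≥0∞, Measurable w → ainfConst w = t →
      wkNorm p w g ≤ K * stNorm p w f := by
  have hp0 : 0 < p₀ := by linarith
  have hT : t + 1 ≠ ⊤ := ENNReal.add_ne_top.2 ⟨ht, by simp⟩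
  obtain ⟨K', hK't, hK'⟩ : ∃ K : ℝ≥0∞, K ≠ ⊤ ∧ ∀ (s : ℝ) (w : (Fin n → ℝ) → ℝ≥0∞),
      GoodW s (t + 1) w → ∫⁻ x, f x ^ p ∂(volume.withDensity w) ≠ 0 →
      ∫⁻ x, f x ^ p ∂(volume.withDensity w) ≠ ⊤ → ∀ y : ℝ≥0∞, y ≠ 0 → y ≠ ⊤ →
        y ^ p * volume.withDensity w {x | y < g x} ≤
          K * ∫⁻ x, f x ^ p ∂(volume.withDensity w) := by
    rcases le_or_gt p p₀ with h | h
    · exact caseA hp₀ hf hg hφ H hp h hT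
    · obtain ⟨K, hK, hK2⟩ := caseB hp₀ hf hg hφ H h hT
      exact ⟨K, hK, fun s w hw _ _ y _ _ => hK2 s w hw y⟩
  refine ⟨max 1 (K' ^ (1 / p)), ?_, ?_⟩
  · exact (max_lt (by simp) (lt_top_iff_ne_top.2
      (ENNReal.rpow_ne_top_of_nonneg (by positivity) hK't))).ne
  intro w hw hwt
  have hip : 0 < 1 / p := by positivity
  have hfp : Measurable fun x => f x ^ p := hf.pow_const _
  have hI : ∫⁻ x, f x ^ p ∂(volume.withDensity w) = ∫⁻ x, f x ^ p * w x := by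
    rw [lintegral_withDensity_eq_lintegral_mul _ hw hfp]
    exact lintegral_congr fun x => mul_comm _ _
  rcases eq_or_ne (∫⁻ x, f x ^ p * w x) 0 with h0 | h0
  · have hae := (lintegral_eq_zero_iff (hfp.mul hw)).1 h0
    have h1 : ∫⁻ x, f x ^ p₀ * w x = 0 := by
      refine (lintegral_eq_zero_iff ((hf.pow_const _).mul hw)).2 ?_
      filter_upwards [hae] with x hx
      have hx' : f x ^ p * w x = 0 := hx
      change f x ^ p₀ * w x = 0
      rcases mul_eq_zero.1 hx' with h | h
      · have : f x = 0 := by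
          rcases ENNReal.rpow_eq_zero_iff.1 h with h | h
          · exact h.1
          · linarith [h.2]
        simp [this, hp0]
      · simp [h]
    have h2 := H w hw (by rw [hwt]; exact lt_top_iff_ne_top.2 ht)
    have h3 : wkNorm p₀ w g = 0 := by
      rw [stNorm, h1, ENNReal.zero_rpow_of_pos (by positivity), mul_zero] at h2
      exact nonpos_iff_eq_zero.1 h2
    have h4 : wkNorm p w g = 0 := by
      rw [wkNorm, ENNReal.iSup_eq_zero] at h3 ⊢
      intro y
      rcases mul_eq_zero.1 (h3 y) with h | h
      · simp [h]
      · have : wMeas w {x | y < g x} = 0 := by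
          rcases ENNReal.rpow_eq_zero_iff.1 h with h | h
          · exact h.1
          · have : 0 < 1 / p₀ := by positivity
            linarith [h.2]
        rw [this, ENNReal.zero_rpow_of_pos hip, mul_zero]
    rw [h4]; exact zero_le
  rcases eq_or_ne (∫⁻ x, f x ^ p * w x) ⊤ with h1 | h1
  · have : stNorm p w f = ⊤ := by rw [stNorm, h1, ENNReal.top_rpow_of_pos hip]
    rw [this, ENNReal.mul_top (by simp)]
    exact le_top
  have hw0 : ¬ ∀ᵐ x, w x = 0 := by
    intro h
    apply h0
    refine (lintegral_eq_zero_iff (hfp.mul hw)).2 ?_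
    filter_upwards [h] with x hx
    simp [hx]
  have hwt' : ¬ ∀ᵐ x, w x = ⊤ := by
    intro h
    have h2 : ∀ᵐ x, f x ^ p = 0 := by
      have h3 := ae_lt_top (hfp.mul hw) h1
      filter_upwards [h, h3] with x hx hx3
      by_contra hne
      simp only [Pi.mul_apply] at hx3
      rw [hx, ENNReal.mul_top hne] at hx3
      exact lt_irrefl _ hx3
    apply h0
    refine (lintegral_eq_zero_iff (hfp.mul hw)).2 ?_
    filter_upwards [h2] with x hx
    simp [hx]
  obtain ⟨s, hs, hap⟩ : ∃ s : ℝ, 1 < s ∧ apConst s w < t + 1 := by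
    have : ainfConst w < t + 1 := by rw [hwt]; exact ENNReal.lt_add_right ht (by simp)
    rw [ainfConst] at this
    obtain ⟨s, hs⟩ := iInf_lt_iff.1 this
    obtain ⟨h, hs⟩ := iInf_lt_iff.1 hs
    exact ⟨s, h, hs⟩
  have hG : GoodW s (t + 1) w := goodW_of hs hT hw hap.le hw0 hwt'
  have hfin := hK' s w hG (by rwa [hI]) (by rwa [hI])
  rw [hI] at hfin
  rw [wkNorm]
  refine iSup_le fun y => ?_
  rcases eq_or_ne y 0 with rfl | hy0
  · rw [zero_mul]; exact zero_le
  rcases eq_or_ne y ⊤ with rfl | hyt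
  · have : {x | ⊤ < g x} = ∅ := by ext x; simp
    rw [this, wMeas, Measure.restrict_empty, lintegral_zero_measure,
      ENNReal.zero_rpow_of_pos hip, mul_zero]
    exact zero_le
  have h2 := ENNReal.rpow_le_rpow (hfin y hy0 hyt) hip.le
  rw [ENNReal.mul_rpow_of_nonneg _ _ hip.le, ENNReal.mul_rpow_of_nonneg _ _ hip.le,
    ← ENNReal.rpow_mul, mul_one_div_cancel hp.ne', ENNReal.rpow_one,
    withDensity_apply _ (measurableSet_lt measurable_const hg)] at h2
  exact h2.trans (mul_le_mul_left (le_max_right _ _) _)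

theorem stmt8 {n : ℕ} (p₀ : ℝ) (hp₀ : 1 ≤ p₀)
    (f g : (Fin n → ℝ) → ℝ≥0∞) (hf : Measurable f) (hg : Measurable g)
    (φ : ℝ≥0∞ → ℝ≥0∞) (hφ : LocBdd φ)
    (H : ∀ w : (Fin n → ℝ) → ℝ≥0∞, Measurable w → ainfConst w < ⊤ →
      wkNorm p₀ w g ≤ φ (ainfConst w) * stNorm p₀ w f) :
    ∀ p : ℝ, 0 < p → ∃ ψ : ℝ≥0∞ → ℝ≥0∞, (∀ t, t ≠ ⊤ → ψ t ≠ ⊤) ∧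
      ∀ w : (Fin n → ℝ) → ℝ≥0∞, Measurable w → ainfConst w < ⊤ →
        wkNorm p w g ≤ ψ (ainfConst w) * stNorm p w f := by
  intro p hp
  have h : ∀ t : ℝ≥0∞, ∃ K : ℝ≥0∞, t ≠ ⊤ → K ≠ ⊤ ∧ ∀ w : (Fin n → ℝ) → ℝ≥0∞, Measurable w →
      ainfConst w = t → wkNorm p w g ≤ K * stNorm p w f := by
    intro t
    rcases eq_or_ne t ⊤ with ht | ht
    · exact ⟨0, fun h => absurd ht h⟩
    · obtain ⟨K, hK⟩ := main_const hp₀ hf hg hφ H hp ht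
      exact ⟨K, fun _ => hK⟩
  choose ψ hψ using h
  exact ⟨ψ, fun t ht => (hψ t ht).1, fun w hw hwt => (hψ _ hwt.ne).2 w hw rfl⟩

end
end
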